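/- Let 0 < p ≤ q < ∞, let ω be a radial continuous weight on the unit disc that is either regular or rapidly increasing, and let μ be a positive Borel measure on 𝔻. Then there exists a constant C > 0 such that ∫_𝔻 |f(z)|^q dμ(z) ≤ C ‖f‖_{A^p_ω}^q for all analytic f on 𝔻 if and only if K := sup_{I ⊂ 𝕋} μ(S(I)) / ω(S(I))^{q/p} < ∞; moreover, when this holds, the best constant C satisfies C ≍ K (constants depending only on p, q, ω). -/

import Mathlib

open MeasureTheory Set Filter

noncomputable section

/-- `wInt ω r = ∫_r^1 ω(s) ds`. -/
def wInt (ω : ℝ → ℝ) (r : ℝ) : ℝ := ∫ s in r..1, ω s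

/-- A radial weight on the unit disc, identified with a function on `[0,1)`:
positive and integrable. -/
def IsRadialWeight (ω : ℝ → ℝ) : Prop :=
  (∀ r ∈ Set.Ico (0:ℝ) 1, 0 < ω r) ∧ IntegrableOn ω (Set.Ico (0:ℝ) 1)

/-- A radial continuous weight. -/
def IsRadialContinuousWeight (ω : ℝ → ℝ) : Prop :=
  IsRadialWeight ω ∧ ContinuousOn ω (Set.Ico (0:ℝ) 1)

/-- A regular weight: radial continuous with `ψ_ω(r) ≍ 1 - r`, i.e.
`(1-r)·ω(r) ≍ ∫_r^1 ω(s) ds` on `[0,1)`. -/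
def IsRegularWeight (ω : ℝ → ℝ) : Prop :=
  IsRadialContinuousWeight ω ∧ ∃ c C : ℝ, 0 < c ∧ 0 < C ∧
    ∀ r ∈ Set.Ico (0:ℝ) 1,
      c * ((1 - r) * ω r) ≤ wInt ω r ∧ wInt ω r ≤ C * ((1 - r) * ω r)

/-- A rapidly increasing weight: radial continuous with
`ψ_ω(r)/(1-r) = (∫_r^1 ω)/(ω(r)(1-r)) → ∞` as `r → 1⁻`. -/
def IsRapidlyIncreasing (ω : ℝ → ℝ) : Prop :=
  IsRadialContinuousWeight ω ∧
    Tendsto (fun r => wInt ω r / (ω r * (1 - r))) (nhdsWithin 1 (Set.Iio 1)) atTop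

/-- The open unit disc in `ℂ`. -/
def unitDisc : Set ℂ := {z : ℂ | ‖z‖ < 1}

/-- The Carleson square `S(I)` associated with the arc `I ⊂ 𝕋` with midpoint `e^{iθ}` and
arc length `h`: `S(I) = {re^{it} ∈ 𝔻 : e^{it} ∈ I, 1 - h ≤ r < 1}`. -/
def CBox (θ h : ℝ) : Set ℂ :=
  {z : ℂ | 1 - h ≤ ‖z‖ ∧ ‖z‖ < 1 ∧
    |Complex.arg (z * Complex.exp (-(θ : ℂ) * Complex.I))| ≤ h / 2}

/-- The weighted (Hörmander) maximal function
`M_ω(φ)(z) = sup_{I : z ∈ S(I)} (1/ω(S(I))) ∫_{S(I)} |φ| ω dA`, with values in `[0,∞]`. -/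
def MaxFn (ω : ℝ → ℝ) (φ : ℂ → ℝ) (z : ℂ) : ENNReal :=
  ⨆ (θ : ℝ) (h : ℝ) (_ : 0 < h ∧ h ≤ 2 * Real.pi ∧ z ∈ CBox θ h),
    (∫⁻ ξ in CBox θ h, ENNReal.ofReal (|φ ξ| * ω ‖ξ‖)) /
      (∫⁻ ξ in CBox θ h, ENNReal.ofReal (ω ‖ξ‖))

theorem exists_nonvanishing_majorant {f : ℂ → ℂ} {R : ℝ} (hR : 0 < R)
    (hf : AnalyticOnNhd ℂ f (Metric.closedBall 0 R)) (hs : ∀ z ∈ Metric.sphere (0:ℂ) R, f z ≠ 0) :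
    ∃ h : ℂ → ℂ, AnalyticOnNhd ℂ h (Metric.closedBall 0 R) ∧
      (∀ z ∈ Metric.closedBall (0:ℂ) R, h z ≠ 0) ∧
      (∀ z ∈ Metric.sphere (0:ℂ) R, ‖h z‖ = ‖f z‖) ∧
      (∀ z ∈ Metric.closedBall (0:ℂ) R, ‖f z‖ ≤ ‖h z‖) := by
  have hRs : (R : ℂ) ∈ Metric.sphere (0:ℂ) R := by simp [abs_of_pos hR]
  have hRb : (R : ℂ) ∈ Metric.closedBall (0:ℂ) R := Metric.sphere_subset_closedBall hRs
  have hmer : MeromorphicOn f (Metric.closedBall 0 R) := hf.meromorphicOn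
  have hne : ∀ u : Metric.closedBall (0:ℂ) R, meromorphicOrderAt f u ≠ ⊤ := by
    have h0 : meromorphicOrderAt f (R:ℂ) ≠ ⊤ := by
      rw [((hf _ hRb).meromorphicNFAt.meromorphicOrderAt_eq_zero_iff).2 (hs _ hRs)]
      simp
    intro u
    exact hmer.meromorphicOrderAt_ne_top_of_isPreconnected
      (convex_closedBall _ _).isPreconnected hRb u.2 h0
  have hfin := (MeromorphicOn.divisor f (Metric.closedBall 0 R)).finiteSupport
    (isCompact_closedBall 0 R)
  obtain ⟨g, hg, hg0, hfg⟩ := hmer.extract_zeros_poles hne hfin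
  set D := MeromorphicOn.divisor f (Metric.closedBall 0 R) with hD
  have hDnn : 0 ≤ D := MeromorphicOn.AnalyticOnNhd.divisor_nonneg hf
  set F : Finset ℂ := hfin.toFinset
  have hFball : ∀ u ∈ F, ‖u‖ < R := by
    intro u hu
    have hu' : D u ≠ 0 := by simpa [F] using hu
    have hub : u ∈ Metric.closedBall (0:ℂ) R := by
      by_contra hc
      exact hu' (D.apply_eq_zero_of_notMem hc)
    rcases lt_or_eq_of_le (mem_closedBall_zero_iff.1 hub) with h | h
    · exact h
    · exfalso
      apply hu'
      rw [hD, MeromorphicOn.divisor_apply hmer hub,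
        ((hf _ hub).meromorphicNFAt.meromorphicOrderAt_eq_zero_iff).2
          (hs _ (mem_sphere_zero_iff_norm.2 h))]
      simp
  have hfg' : ∀ z ∈ Metric.closedBall (0:ℂ) R, f z = (∏ u ∈ F, (z - u) ^ (D u).toNat) * g z := by
    have hP : (∏ᶠ u, (fun z : ℂ ↦ z - u) ^ D u) = fun z ↦ ∏ u ∈ F, (z - u) ^ (D u).toNat := by
      rw [finprod_eq_prod_of_mulSupport_subset (s := F)]
      · ext z
        simp only [Finset.prod_apply, Pi.pow_apply]
        refine Finset.prod_congr rfl fun u _ ↦ ?_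
        rw [← zpow_natCast, Int.toNat_of_nonneg (hDnn u)]
      · intro u hu
        simp only [Function.mem_mulSupport] at hu
        simp only [F, Finite.coe_toFinset, Function.mem_support]
        intro hc
        exact hu (by simp [hc])
    rw [hP] at hfg
    intro z hz
    set k : ℂ → ℂ := fun z ↦ (∏ u ∈ F, (z - u) ^ (D u).toNat) * g z
    have hk : AnalyticOnNhd ℂ k (Metric.closedBall 0 R) := by
      intro w hw
      refine AnalyticAt.mul ?_ (hg w hw)
      fun_prop
    have h1 := (hf z hz).meromorphicAt.eventuallyEq_nhdsNE_of_eventuallyEq_codiscreteWithin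
      (hk z hz).meromorphicAt hz ?_ hfg
    · have := ((hf z hz).continuousAt.eventuallyEq_nhds_iff_eventuallyEq_nhdsNE
        (hk z hz).continuousAt).1 h1
      exact this.eq_of_nhds
    · refine (IsPreconnected.preperfect_of_nontrivial ?_
        (convex_closedBall (0:ℂ) R).isPreconnected) z hz
      refine ⟨R, hRb, 0, Metric.mem_closedBall_self hR.le, ?_⟩
      exact_mod_cast hR.ne'
  have hsq (u z : ℂ) : ‖(R:ℂ) ^ 2 - (starRingEnd ℂ) u * z‖ ^ 2 - R ^ 2 * ‖z - u‖ ^ 2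
      = (R ^ 2 - ‖u‖ ^ 2) * (R ^ 2 - ‖z‖ ^ 2) := by
    simp only [← Complex.normSq_eq_norm_sq, Complex.normSq_apply, Complex.sub_re, Complex.sub_im,
      Complex.mul_re, Complex.mul_im, Complex.conj_re, Complex.conj_im, ← Complex.ofReal_pow,
      Complex.ofReal_re, Complex.ofReal_im]
    ring
  have hnR (w : ℂ) : ‖w / (R:ℂ)‖ = ‖w‖ / R := by simp [abs_of_pos hR]
  have hsq_eq (u z : ℂ) (hz : ‖z‖ = R) :
      ‖((R:ℂ) ^ 2 - (starRingEnd ℂ) u * z) / R‖ = ‖z - u‖ := by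
    rw [hnR, div_eq_iff hR.ne', ← sq_eq_sq₀ (norm_nonneg _) (by positivity)]
    have := hsq u z
    rw [hz] at this
    linarith
  have hsq_le (u z : ℂ) (hu : ‖u‖ ≤ R) (hz : ‖z‖ ≤ R) :
      ‖z - u‖ ≤ ‖((R:ℂ) ^ 2 - (starRingEnd ℂ) u * z) / R‖ := by
    rw [hnR, le_div_iff₀ hR, ← sq_le_sq₀ (by positivity) (norm_nonneg _)]
    have h1 : 0 ≤ R ^ 2 - ‖u‖ ^ 2 := by nlinarith [norm_nonneg u]
    have h2 : 0 ≤ R ^ 2 - ‖z‖ ^ 2 := by nlinarith [norm_nonneg z]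
    nlinarith [hsq u z, mul_nonneg h1 h2]
  refine ⟨fun z ↦ (∏ u ∈ F, (((R:ℂ) ^ 2 - (starRingEnd ℂ) u * z) / R) ^ (D u).toNat) * g z,
    ?_, ?_, ?_, ?_⟩
  · intro w hw
    refine AnalyticAt.mul ?_ (hg w hw)
    fun_prop
  · intro z hz
    refine mul_ne_zero (Finset.prod_ne_zero_iff.2 fun u hu ↦ pow_ne_zero _ ?_) (hg0 ⟨z, hz⟩)
    refine div_ne_zero ?_ (by exact_mod_cast hR.ne')
    intro hc
    have h1 : ‖(starRingEnd ℂ) u * z‖ = R ^ 2 := by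
      rw [← sub_eq_zero.1 hc]
      simp
    rw [norm_mul, RCLike.norm_conj] at h1
    have h2 := hFball u hu
    have h3 := mem_closedBall_zero_iff.1 hz
    nlinarith [norm_nonneg u, norm_nonneg z]
  · intro z hz
    rw [hfg' z (Metric.sphere_subset_closedBall hz), norm_mul, norm_mul, norm_prod, norm_prod]
    congr 1
    refine Finset.prod_congr rfl fun u hu ↦ ?_
    rw [norm_pow, norm_pow]
    congr 1
    have hz' : ‖z‖ = R := mem_sphere_zero_iff_norm.1 hz
    exact hsq_eq u z hz'
  · intro z hz
    rw [hfg' z hz, norm_mul, norm_mul, norm_prod, norm_prod]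
    gcongr with u hu
    rw [norm_pow, norm_pow]
    gcongr
    exact hsq_le u z (hFball u hu).le (mem_closedBall_zero_iff.1 hz)

theorem norm_rpow_le_circleAverage {f : ℂ → ℂ} {R α : ℝ} {a : ℂ} (ha : ‖a‖ < R) (hα : 0 < α)
    (hf : AnalyticOnNhd ℂ f (Metric.closedBall 0 R)) (hs : ∀ z ∈ Metric.sphere (0:ℂ) R, f z ≠ 0) :
    ‖f a‖ ^ α ≤ (R + ‖a‖) / (R - ‖a‖) * Real.circleAverage (fun z ↦ ‖f z‖ ^ α) 0 R := by
  have hR : 0 < R := (norm_nonneg a).trans_lt ha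
  obtain ⟨h, hh, hh0, hhs, hhle⟩ := exists_nonvanishing_majorant hR hf hs
  have haB : a ∈ Metric.ball (0:ℂ) R := mem_ball_zero_iff.2 ha
  have hharm : Metric.closedBall (0:ℂ) R ⊆
      {x | InnerProductSpace.HarmonicAt (fun z ↦ Real.log ‖h z‖) x} :=
    fun z hz ↦ (hh z hz).harmonicAt_log_norm (hh0 z hz)
  obtain ⟨e, he, hsub⟩ := (isCompact_closedBall (0:ℂ) R).exists_thickening_subset_open
    (InnerProductSpace.isOpen_setOfPred_harmonicAt _) hharm
  rw [thickening_closedBall he hR.le] at hsub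
  obtain ⟨G, hG, hGre⟩ := InnerProductSpace.HarmonicOnNhd.exists_analyticOnNhd_ball_re_eq
    (f := fun z ↦ Real.log ‖h z‖) (z := 0) (R := e + R) (fun x hx ↦ hsub hx)
  have hcb : Metric.closedBall (0:ℂ) R ⊆ Metric.ball 0 (e + R) :=
    Metric.closedBall_subset_ball (by linarith)
  set H : ℂ → ℂ := fun z ↦ Complex.exp (α * G z) with hH
  have hHnorm : ∀ z ∈ Metric.closedBall (0:ℂ) R, ‖H z‖ = ‖h z‖ ^ α := by
    intro z hz
    have h1 := hGre (hcb hz)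
    simp only at h1
    rw [hH, Complex.norm_exp, Complex.re_ofReal_mul, h1,
      Real.rpow_def_of_pos (norm_pos_iff.2 (hh0 z hz)), mul_comm]
  have hHdiff : DifferentiableOn ℂ H (Metric.ball 0 (e + R)) := by
    have := hG.differentiableOn
    fun_prop
  have hHd : DiffContOnCl ℂ H (Metric.ball 0 R) := by
    refine DifferentiableOn.diffContOnCl ?_
    exact hHdiff.mono (by rwa [closure_ball _ hR.ne'])
  have hpois := hHd.circleAverage_poissonKernel_smul haB
  have hcont : ContinuousOn (fun z ↦ ‖f z‖ ^ α) (Metric.sphere 0 R) := by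
    refine ContinuousOn.rpow_const ?_ fun _ _ ↦ Or.inr hα.le
    exact (hf.continuousOn.mono Metric.sphere_subset_closedBall).norm
  calc ‖f a‖ ^ α ≤ ‖h a‖ ^ α := by
        gcongr
        exact hhle a (Metric.ball_subset_closedBall haB)
    _ = ‖H a‖ := (hHnorm a (Metric.ball_subset_closedBall haB)).symm
    _ = ‖Real.circleAverage (poissonKernel 0 a • H) 0 R‖ := by rw [hpois]
    _ ≤ (R + ‖a‖) / (R - ‖a‖) * Real.circleAverage (fun z ↦ ‖f z‖ ^ α) 0 R := by
        rw [Real.circleAverage, Real.circleAverage, norm_smul, smul_eq_mul, mul_left_comm,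
          Real.norm_of_nonneg (by positivity)]
        gcongr
        rw [← intervalIntegral.integral_const_mul]
        refine intervalIntegral.norm_integral_le_of_norm_le (by positivity) ?_ ?_
        · refine Filter.Eventually.of_forall fun t _ ↦ ?_
          have hm : circleMap 0 R t ∈ Metric.sphere (0:ℂ) R := circleMap_mem_sphere _ hR.le _
          rw [Pi.smul_apply', norm_smul, hHnorm _ (Metric.sphere_subset_closedBall hm), hhs _ hm]
          gcongr
          rw [Real.norm_eq_abs, poissonKernel_eq_re_herglotzRieszKernel]
          have hle := re_herglotzRieszKernel_le hm haB
          have hge := le_re_herglotzRieszKernel hm haB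
          rw [Function.comp_apply, herglotzRieszKernel_def, abs_of_nonneg]
          · simpa using hle
          · refine le_trans ?_ hge
            have : 0 < R - ‖a - 0‖ := by simpa using ha
            positivity
        · refine ContinuousOn.intervalIntegrable ?_
          refine continuousOn_const.mul ?_
          refine hcont.comp (continuous_circleMap 0 R).continuousOn fun t _ ↦ ?_
          exact circleMap_mem_sphere _ hR.le _

theorem ofReal_norm_rpow_le_lintegral {f : ℂ → ℂ} {R α : ℝ} {a : ℂ} (ha : ‖a‖ < R) (hα : 0 < α)
    (hf : AnalyticOnNhd ℂ f (Metric.closedBall 0 R)) (hs : ∀ z ∈ Metric.sphere (0:ℂ) R, f z ≠ 0) :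
    ENNReal.ofReal (‖f a‖ ^ α) ≤ ENNReal.ofReal ((R + ‖a‖) / (R - ‖a‖)) *
      ∫⁻ t in Ioo (-Real.pi) Real.pi,
        ENNReal.ofReal (‖f (Complex.polarCoord.symm (R, t))‖ ^ α) := by
  have hR : 0 < R := (norm_nonneg a).trans_lt ha
  have hcont : Continuous (fun t ↦ ‖f (circleMap 0 R t)‖ ^ α) := by
    refine Continuous.rpow_const ?_ fun _ ↦ Or.inr hα.le
    refine Continuous.norm ?_
    exact hf.continuousOn.comp_continuous (continuous_circleMap 0 R)
      fun t ↦ circleMap_mem_closedBall _ hR.le _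
  have hq : 0 ≤ (R + ‖a‖) / (R - ‖a‖) := by
    have : 0 < R - ‖a‖ := by linarith
    positivity
  refine (ENNReal.ofReal_le_ofReal (norm_rpow_le_circleAverage ha hα hf hs)).trans ?_
  rw [ENNReal.ofReal_mul hq]
  gcongr
  have h1 : Real.circleAverage (fun z ↦ ‖f z‖ ^ α) 0 R
      ≤ ∫ t in Ioo (-Real.pi) Real.pi, ‖f (circleMap 0 R t)‖ ^ α := by
    have hper : Function.Periodic (fun t ↦ ‖f (circleMap 0 R t)‖ ^ α) (2 * Real.pi) := by
      intro t
      simp only [periodic_circleMap 0 R t]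
    have := hper.intervalIntegral_add_eq 0 (-Real.pi)
    rw [Real.circleAverage, smul_eq_mul]
    rw [show (0 + 2 * Real.pi) = 2 * Real.pi by ring,
      show -Real.pi + 2 * Real.pi = Real.pi by ring] at this
    rw [this, intervalIntegral.integral_of_le (by linarith [Real.pi_pos]),
      integral_Ioc_eq_integral_Ioo]
    refine mul_le_of_le_one_left (integral_nonneg fun t ↦ by positivity) ?_
    refine inv_le_one_of_one_le₀ ?_
    linarith [Real.pi_gt_three]
  refine (ENNReal.ofReal_le_ofReal h1).trans ?_
  rw [ofReal_integral_eq_lintegral_ofReal]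
  · refine le_of_eq (lintegral_congr fun t ↦ ?_)
    rw [Complex.polarCoord_symm_apply, circleMap, Complex.exp_mul_I]
    simp
  · exact (hcont.integrableOn_Icc (a := -Real.pi) (b := Real.pi)).mono_set Ioo_subset_Icc_self
  · exact Filter.Eventually.of_forall fun t ↦ by positivity

theorem intervalIntegrable_weight {ω : ℝ → ℝ} (hint : IntegrableOn ω (Ico (0:ℝ) 1))
    {a b : ℝ} (ha : 0 ≤ a) (hab : a ≤ b) (hb : b ≤ 1) : IntervalIntegrable ω volume a b := by
  rw [intervalIntegrable_iff_integrableOn_Ico_of_le hab]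
  exact hint.mono_set (Ico_subset_Ico ha hb)

theorem ofReal_wInt {ω : ℝ → ℝ} (hω : IsRadialWeight ω) {r : ℝ} (hr : 0 ≤ r) (hr1 : r ≤ 1) :
    ENNReal.ofReal (wInt ω r) = ∫⁻ s in Ico r 1, ENNReal.ofReal (ω s) := by
  have hsub : Ico r 1 ⊆ Ico (0:ℝ) 1 := Ico_subset_Ico_left hr
  rw [wInt, intervalIntegral.integral_of_le hr1, integral_Ioc_eq_integral_Ioo,
    ← integral_Ico_eq_integral_Ioo, ofReal_integral_eq_lintegral_ofReal (hω.2.mono_set hsub)]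
  filter_upwards [ae_restrict_mem measurableSet_Ico] with s hs using (hω.1 s (hsub hs)).le

theorem wInt_sub {ω : ℝ → ℝ} (hω : IsRadialWeight ω) {a b : ℝ} (ha : 0 ≤ a) (hab : a ≤ b)
    (hb : b ≤ 1) : wInt ω a - wInt ω b = ∫ s in a..b, ω s := by
  have h := intervalIntegral.integral_add_adjacent_intervals
    (intervalIntegrable_weight hω.2 ha hab hb)
    (intervalIntegrable_weight hω.2 (ha.trans hab) hb le_rfl)
  rw [wInt, wInt, ← h]; ring

theorem wInt_nonneg {ω : ℝ → ℝ} (hω : IsRadialWeight ω) {r : ℝ} (hr : 0 ≤ r) (hr1 : r ≤ 1) :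
    0 ≤ wInt ω r := by
  rw [wInt, intervalIntegral.integral_of_le hr1, integral_Ioc_eq_integral_Ioo]
  exact setIntegral_nonneg measurableSet_Ioo fun s hs ↦ (hω.1 s ⟨hr.trans hs.1.le, hs.2⟩).le

theorem wInt_anti {ω : ℝ → ℝ} (hω : IsRadialWeight ω) {a b : ℝ} (ha : 0 ≤ a) (hab : a ≤ b)
    (hb : b ≤ 1) : wInt ω b ≤ wInt ω a := by
  have h := wInt_sub hω ha hab hb
  have : 0 ≤ ∫ s in a..b, ω s := by
    rw [intervalIntegral.integral_of_le hab, integral_Ioc_eq_integral_Ioo]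
    exact setIntegral_nonneg measurableSet_Ioo fun s hs ↦
      (hω.1 s ⟨ha.trans hs.1.le, hs.2.trans_le hb⟩).le
  linarith

theorem wInt_pos {ω : ℝ → ℝ} (hω : IsRadialWeight ω) {r : ℝ} (hr : 0 ≤ r) (hr1 : r < 1) :
    0 < wInt ω r :=
  intervalIntegral.intervalIntegral_pos_of_pos_on
    (intervalIntegrable_weight hω.2 hr hr1.le le_rfl)
    (fun s hs ↦ hω.1 s ⟨hr.trans hs.1.le, hs.2⟩) hr1

theorem exists_mul_le_wInt {ω : ℝ → ℝ} (hω : IsRegularWeight ω ∨ IsRapidlyIncreasing ω) :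
    ∃ c : ℝ, 0 < c ∧ ∀ r ∈ Ico (0:ℝ) 1, c * ((1 - r) * ω r) ≤ wInt ω r := by
  rcases hω with ⟨-, c, C, hc, -, h⟩ | ⟨⟨hw, hcont⟩, hlim⟩
  · exact ⟨c, hc, fun r hr ↦ (h r hr).1⟩
  have h1 := hlim.eventually_ge_atTop 1
  obtain ⟨a, ha, ha'⟩ := (mem_nhdsLT_iff_exists_Ioo_subset).1 h1
  set r₀ := max a 0
  have hr₀ : r₀ < 1 := max_lt ha one_pos
  obtain ⟨B, hB⟩ := (isCompact_Icc (a := (0:ℝ)) (b := r₀)).bddAbove_image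
    (hcont.mono fun x hx ↦ ⟨hx.1, hx.2.trans_lt hr₀⟩)
  have hB0 : 0 < B := (hw.1 0 ⟨le_rfl, one_pos⟩).trans_le
    (hB ⟨0, ⟨le_rfl, le_max_right _ _⟩, rfl⟩)
  have hW := wInt_pos hw (le_max_right a 0) hr₀
  refine ⟨min 1 (wInt ω r₀ / B), lt_min one_pos (by positivity), fun r hr ↦ ?_⟩
  have hωr := hw.1 r hr
  have h1r : 0 < 1 - r := by linarith [hr.2]
  rcases le_or_gt r r₀ with h | h
  · calc min 1 (wInt ω r₀ / B) * ((1 - r) * ω r) ≤ wInt ω r₀ / B * (1 * B) := by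
          gcongr
          · exact min_le_right _ _
          · linarith [hr.1]
          · exact hB ⟨r, ⟨hr.1, h⟩, rfl⟩
      _ = wInt ω r₀ := by field_simp
      _ ≤ wInt ω r := wInt_anti hw hr.1 h hr₀.le
  · have : 1 ≤ wInt ω r / (ω r * (1 - r)) := ha' ⟨(le_max_left _ _).trans_lt h, hr.2⟩
    rw [le_div_iff₀ (by positivity)] at this
    calc min 1 (wInt ω r₀ / B) * ((1 - r) * ω r) ≤ 1 * ((1 - r) * ω r) := by
          gcongr; exact min_le_left _ _
      _ ≤ wInt ω r := by linarith

theorem exists_wInt_le_midpoint {ω : ℝ → ℝ} (hω : IsRadialWeight ω) {c : ℝ} (hc : 0 < c)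
    (h : ∀ r ∈ Ico (0:ℝ) 1, c * ((1 - r) * ω r) ≤ wInt ω r) :
    ∃ D : ℝ, 0 < D ∧ ∀ r ∈ Ico (0:ℝ) 1, wInt ω r ≤ D * wInt ω ((1 + r) / 2) := by
  obtain ⟨l, hl0, hl1, hl⟩ : ∃ l : ℝ, 0 < l ∧ l < 1 ∧ (1 - l) / (c * l) ≤ 1 / 2 := by
    refine ⟨2 / (c + 2), by positivity, by rw [div_lt_one (by positivity)]; linarith, ?_⟩
    rw [div_le_iff₀ (by positivity)]
    field_simp
    linarith
  have hstep : ∀ r ∈ Ico (0:ℝ) 1, wInt ω r ≤ 2 * wInt ω (1 - l * (1 - r)) := by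
    intro r hr
    have h1r : 0 < 1 - r := by linarith [hr.2]
    have hlr : 0 < l * (1 - r) := by positivity
    have hle : r ≤ 1 - l * (1 - r) := by nlinarith
    have hsub := wInt_sub hω hr.1 hle (by linarith)
    have hb : ∫ s in r..(1 - l * (1 - r)), ω s ≤
        ∫ s in r..(1 - l * (1 - r)), wInt ω r / (c * (l * (1 - r))) := by
      refine intervalIntegral.integral_mono_on hle
        (intervalIntegrable_weight hω.2 hr.1 hle (by linarith)) (by simp) fun s hs ↦ ?_
      have hs1 : s ∈ Ico (0:ℝ) 1 := ⟨hr.1.trans hs.1, by linarith [hs.2]⟩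
      rw [le_div_iff₀ (by positivity)]
      have := hω.1 s hs1
      calc ω s * (c * (l * (1 - r))) ≤ ω s * (c * (1 - s)) := by
            gcongr; linarith [hs.2]
        _ = c * ((1 - s) * ω s) := by ring
        _ ≤ wInt ω s := h s hs1
        _ ≤ wInt ω r := wInt_anti hω hr.1 hs.1 hs1.2.le
    rw [intervalIntegral.integral_const, smul_eq_mul] at hb
    have : (1 - l * (1 - r) - r) * (wInt ω r / (c * (l * (1 - r)))) =
        (1 - l) / (c * l) * wInt ω r := by field_simp; ring
    rw [this] at hb
    have := mul_le_mul_of_nonneg_right hl (wInt_nonneg hω hr.1 hr.2.le)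
    linarith
  have hiter : ∀ n : ℕ, ∀ r ∈ Ico (0:ℝ) 1, wInt ω r ≤ 2 ^ n * wInt ω (1 - l ^ n * (1 - r)) := by
    intro n
    induction n with
    | zero => intro r hr; simp
    | succ n ih =>
      intro r hr
      have h1r : 0 < 1 - r := by linarith [hr.2]
      have hp : 0 < l ^ n * (1 - r) := by positivity
      have hp1 : l ^ n ≤ 1 := pow_le_one₀ hl0.le hl1.le
      have := hstep (1 - l ^ n * (1 - r)) ⟨by nlinarith [hr.1], by linarith⟩
      calc wInt ω r ≤ _ := ih r hr
        _ ≤ 2 ^ n * (2 * wInt ω (1 - l * (1 - (1 - l ^ n * (1 - r))))) := by gcongr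
        _ = _ := by
          rw [show 1 - l * (1 - (1 - l ^ n * (1 - r))) = 1 - l ^ (n + 1) * (1 - r) by ring]; ring
  obtain ⟨n, hn⟩ := exists_pow_lt_of_lt_one (by norm_num : (0:ℝ) < 1 / 2) hl1
  refine ⟨2 ^ n, by positivity, fun r hr ↦ (hiter n r hr).trans ?_⟩
  have h1r : 0 < 1 - r := by linarith [hr.2]
  gcongr
  refine wInt_anti hω (by linarith [hr.1]) ?_ ?_
  · nlinarith
  · have : 0 < l ^ n := by positivity
    nlinarith

/-- The mass of `ω(ρ) ρ dρ` on the annulus of width `h` at the unit circle. -/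
def annulusMass (ω : ℝ → ℝ) (h : ℝ) : ENNReal :=
  ∫⁻ ρ in Ioi 0 ∩ Ico (1 - h) 1, ENNReal.ofReal ρ * ENNReal.ofReal (ω ρ)

theorem annulusMass_le {ω : ℝ → ℝ} (hω : IsRadialWeight ω) {h : ℝ} (hh : 0 < h) :
    annulusMass ω h ≤ ENNReal.ofReal (wInt ω (max (1 - h) 0)) := by
  rw [ofReal_wInt hω (le_max_right _ _) (max_le (by linarith) zero_le_one)]
  have hsub : Ioi 0 ∩ Ico (1 - h) 1 ⊆ Ico (max (1 - h) 0) 1 :=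
    fun x hx ↦ ⟨max_le hx.2.1 (le_of_lt hx.1), hx.2.2⟩
  refine le_trans (setLIntegral_mono' (measurableSet_Ioi.inter measurableSet_Ico) fun x hx ↦ ?_)
    (lintegral_mono_set hsub)
  exact mul_le_of_le_one_left' (by simpa using hx.2.2.le)

theorem le_annulusMass {ω : ℝ → ℝ} (hω : IsRadialWeight ω) {h r : ℝ}
    (hr : 1 / 2 ≤ r) (hrh : 1 - h ≤ r) (hr1 : r ≤ 1) :
    ENNReal.ofReal (wInt ω r) ≤ 2 * annulusMass ω h := by
  rw [ofReal_wInt hω (by linarith) hr1, annulusMass, ← lintegral_const_mul' _ _ (by simp)]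
  have hsub : Ico r 1 ⊆ Ioi 0 ∩ Ico (1 - h) 1 :=
    fun x hx ↦ ⟨by rw [mem_Ioi]; linarith [hx.1], hrh.trans hx.1, hx.2⟩
  refine le_trans (setLIntegral_mono' measurableSet_Ico fun x hx ↦ ?_) (lintegral_mono_set hsub)
  rw [← mul_assoc]
  refine le_mul_of_one_le_left' ?_
  rw [show (2:ENNReal) = ENNReal.ofReal 2 by simp, ← ENNReal.ofReal_mul (by norm_num)]
  rw [ENNReal.one_le_ofReal]
  linarith [hx.1]

theorem annulusMass_lt_top {ω : ℝ → ℝ} (hω : IsRadialWeight ω) {h : ℝ} (hh : 0 < h) :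
    annulusMass ω h < ⊤ := (annulusMass_le hω hh).trans_lt ENNReal.ofReal_lt_top

theorem annulusMass_pos {ω : ℝ → ℝ} (hω : IsRadialWeight ω) {h : ℝ} (hh : 0 < h) :
    0 < annulusMass ω h := by
  have := le_annulusMass hω (le_max_left (1 / 2) (1 - h)) (le_max_right _ _)
    (max_le (by norm_num) (by linarith))
  rw [pos_iff_ne_zero]
  intro h0
  rw [h0, mul_zero, nonpos_iff_eq_zero, ENNReal.ofReal_eq_zero] at this
  exact absurd (wInt_pos hω (by positivity) (max_lt (by norm_num) (by linarith))) this.not_gt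

theorem exists_annulusMass_doubling {ω : ℝ → ℝ}
    (hω : IsRegularWeight ω ∨ IsRapidlyIncreasing ω) :
    ∃ D : ℝ, 0 < D ∧ ∀ h > 0, annulusMass ω (2 * h) ≤ ENNReal.ofReal D * annulusMass ω h := by
  have hw : IsRadialWeight ω := by rcases hω with h | h <;> exact h.1.1
  obtain ⟨c, hc, hcω⟩ := exists_mul_le_wInt hω
  obtain ⟨D, hD, h⟩ := exists_wInt_le_midpoint hw hc hcω
  refine ⟨2 * D, by positivity, fun h' hh' ↦ ?_⟩
  set r := max (1 - 2 * h') 0 with hr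
  have hr0 : 0 ≤ r := le_max_right _ _
  have hr1 : r < 1 := max_lt (by linarith) one_pos
  have hrh : 1 - 2 * h' ≤ r := le_max_left _ _
  calc annulusMass ω (2 * h') ≤ ENNReal.ofReal (wInt ω r) := annulusMass_le hw (by linarith)
    _ ≤ ENNReal.ofReal (D * wInt ω ((1 + r) / 2)) := ENNReal.ofReal_le_ofReal (h r ⟨hr0, hr1⟩)
    _ = ENNReal.ofReal D * ENNReal.ofReal (wInt ω ((1 + r) / 2)) := ENNReal.ofReal_mul hD.le
    _ ≤ ENNReal.ofReal D * (2 * annulusMass ω h') := by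
        gcongr
        exact le_annulusMass hw (by linarith) (by linarith) (by linarith)
    _ = _ := by
        rw [mul_comm 2 D, ENNReal.ofReal_mul hD.le]; simp [mul_assoc]

theorem measurableSet_CBox (θ h : ℝ) : MeasurableSet (CBox θ h) := by
  have h1 : MeasurableSet {z : ℂ | 1 - h ≤ ‖z‖} := measurableSet_le measurable_const measurable_norm
  have h2 : MeasurableSet {z : ℂ | ‖z‖ < 1} := measurableSet_lt measurable_norm measurable_const
  have h3 : MeasurableSet {z : ℂ |
      |Complex.arg (z * Complex.exp (-(θ : ℂ) * Complex.I))| ≤ h / 2} := by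
    refine measurableSet_le ?_ measurable_const
    exact (Complex.measurable_arg.comp (measurable_id.mul_const _)).norm
  exact h1.inter (h2.inter h3)

theorem CBox_subset_unitDisc (θ h : ℝ) : CBox θ h ⊆ unitDisc := fun _ hz ↦ hz.2.1

theorem CBox_mono (θ : ℝ) {h h' : ℝ} (hh : h ≤ h') : CBox θ h ⊆ CBox θ h' :=
  fun _ hz ↦ ⟨by linarith [hz.1], hz.2.1, by linarith [hz.2.2]⟩

theorem CBox_eq_unitDisc (θ : ℝ) {h : ℝ} (hh : 2 * Real.pi ≤ h) : CBox θ h = unitDisc := by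
  refine (CBox_subset_unitDisc θ h).antisymm fun z hz ↦ ⟨?_, hz, ?_⟩
  · linarith [norm_nonneg z, Real.pi_gt_three]
  · linarith [Complex.abs_arg_le_pi (z * Complex.exp (-(θ : ℂ) * Complex.I))]

theorem abs_arg_mul_exp (θ : ℝ) {z : ℂ} (hz : z ≠ 0) :
    |Complex.arg (z * Complex.exp (-(θ : ℂ) * Complex.I))| =
      InnerProductGeometry.angle z (Complex.exp (θ * Complex.I)) := by
  rw [Complex.angle_eq_abs_arg hz (Complex.exp_ne_zero _), neg_mul, Complex.exp_neg, div_eq_mul_inv]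

theorem CBox_subset_of_inter {θ θ' h h' : ℝ} (hh' : 0 < h') (hle : h ≤ 2 * h')
    (hne : (CBox θ h ∩ CBox θ' h').Nonempty) : CBox θ h ⊆ CBox θ' (8 * h') := by
  obtain ⟨w, hw, hw'⟩ := hne
  rcases le_or_gt (2 * Real.pi) (8 * h') with h8 | h8
  · rw [CBox_eq_unitDisc θ' h8]; exact CBox_subset_unitDisc θ h
  have hlt : h' < 1 := by linarith [Real.pi_lt_four]
  have hw0 : w ≠ 0 := by
    rintro rfl
    have := hw'.1
    rw [norm_zero] at this
    linarith
  intro z hz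
  rcases eq_or_ne z 0 with rfl | hz0
  · refine ⟨?_, hz.2.1, by simp; positivity⟩
    linarith [hz.1]
  refine ⟨by linarith [hz.1], hz.2.1, ?_⟩
  have e1 := hz.2.2
  have e2 := hw.2.2
  have e3 := hw'.2.2
  rw [abs_arg_mul_exp _ hz0] at e1 ⊢
  rw [abs_arg_mul_exp _ hw0] at e2 e3
  have t1 := InnerProductGeometry.angle_le_angle_add_angle z (Complex.exp (θ * Complex.I))
    (Complex.exp (θ' * Complex.I))
  have t2 := InnerProductGeometry.angle_le_angle_add_angle (Complex.exp (θ * Complex.I)) w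
    (Complex.exp (θ' * Complex.I))
  rw [InnerProductGeometry.angle_comm (Complex.exp (θ * Complex.I)) w] at t2
  linarith

theorem exists_mem_CBox {h : ℝ} (hh : 0 < h) (θ : ℝ) : (CBox θ h).Nonempty := by
  have hm : max (1 - h) 0 < 1 := max_lt (by linarith) one_pos
  have hm0 : 0 ≤ max (1 - h) 0 := le_max_right _ _
  refine ⟨(max (1 - h) 0 : ℝ) * Complex.exp (θ * Complex.I), ?_, ?_, ?_⟩
  · rw [norm_mul, Complex.norm_exp_ofReal_mul_I, mul_one, Complex.norm_real, Real.norm_eq_abs,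
      abs_of_nonneg hm0]
    exact le_max_left _ _
  · rw [norm_mul, Complex.norm_exp_ofReal_mul_I, mul_one, Complex.norm_real, Real.norm_eq_abs,
      abs_of_nonneg hm0]
    exact hm
  · rw [mul_assoc, ← Complex.exp_add]
    simp [Complex.arg_ofReal_of_nonneg]
    positivity

/-- The measure `ω dA` on the unit disc. -/
def weightMeasure (ω : ℝ → ℝ) : Measure ℂ :=
  volume.withDensity (unitDisc.indicator fun ξ ↦ ENNReal.ofReal (ω ‖ξ‖))

theorem measurableSet_unitDisc : MeasurableSet unitDisc :=
  measurableSet_lt measurable_norm measurable_const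

theorem measurable_density {ω : ℝ → ℝ} (hω : ContinuousOn ω (Ico 0 1)) :
    Measurable (unitDisc.indicator fun ξ ↦ ENNReal.ofReal (ω ‖ξ‖)) := by
  have hc : ContinuousOn (fun ξ : ℂ ↦ ENNReal.ofReal (ω ‖ξ‖)) unitDisc :=
    ENNReal.continuous_ofReal.comp_continuousOn
      (hω.comp continuous_norm.continuousOn fun ξ hξ ↦ ⟨norm_nonneg _, hξ⟩)
  classical
  rw [← piecewise_eq_indicator]
  exact hc.measurable_piecewise continuousOn_const measurableSet_unitDisc

theorem weightMeasure_apply (ω : ℝ → ℝ) {s : Set ℂ} (hs : MeasurableSet s) (hsub : s ⊆ unitDisc) :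
    weightMeasure ω s = ∫⁻ ξ in s, ENNReal.ofReal (ω ‖ξ‖) := by
  rw [weightMeasure, withDensity_apply _ hs]
  exact setLIntegral_congr_fun hs fun ξ hξ ↦ indicator_of_mem (hsub hξ) _

theorem lintegral_weightMeasure {ω : ℝ → ℝ} (hω : ContinuousOn ω (Ico 0 1)) (φ : ℂ → ENNReal) :
    ∫⁻ z, φ z ∂(weightMeasure ω) = ∫⁻ z in unitDisc, φ z * ENNReal.ofReal (ω ‖z‖) := by
  rw [weightMeasure, lintegral_withDensity_eq_lintegral_mul_non_measurable _ (measurable_density hω),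
    ← lintegral_indicator measurableSet_unitDisc]
  · refine lintegral_congr fun z ↦ ?_
    by_cases hz : z ∈ unitDisc <;> simp [hz, mul_comm]
  · refine Eventually.of_forall fun z ↦ ?_
    by_cases hz : z ∈ unitDisc <;> simp [hz]

theorem lintegral_weightMeasure_polar {ω : ℝ → ℝ} (hω : ContinuousOn ω (Ico 0 1))
    {φ : ℂ → ENNReal} (hφ : Measurable φ) :
    ∫⁻ z, φ z ∂(weightMeasure ω) = ∫⁻ ρ in Ioo 0 1, ENNReal.ofReal ρ * ENNReal.ofReal (ω ρ) *
      ∫⁻ t in Ioo (-Real.pi) Real.pi, φ (Complex.polarCoord.symm (ρ, t)) := by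
  have hd := measurable_density hω
  have hsymm : Measurable fun p : ℝ × ℝ ↦ Complex.polarCoord.symm p := by
    simp_rw [Complex.polarCoord_symm_apply]
    fun_prop
  rw [weightMeasure, lintegral_withDensity_eq_lintegral_mul _ hd hφ,
    ← Complex.lintegral_comp_polarCoord_symm, polarCoord_target, Measure.volume_eq_prod,
    ← Measure.prod_restrict, lintegral_prod]
  swap
  · exact (((measurable_fst.ennreal_ofReal).smul ((hd.mul hφ).comp hsymm))).aemeasurable
  rw [← lintegral_indicator measurableSet_Ioi, ← lintegral_indicator measurableSet_Ioo]
  refine lintegral_congr fun ρ ↦ ?_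
  by_cases hρ : 0 < ρ
  swap
  · rw [indicator_of_notMem (by simpa using hρ), indicator_of_notMem (by simp [hρ])]
  rw [indicator_of_mem (by simpa using hρ)]
  have hn : ∀ t, ‖Complex.polarCoord.symm (ρ, t)‖ = ρ := fun t ↦ by
    rw [Complex.norm_polarCoord_symm, abs_of_pos hρ]
  by_cases h1 : ρ < 1
  · rw [indicator_of_mem (show ρ ∈ Ioo (0:ℝ) 1 from ⟨hρ, h1⟩),
      ← lintegral_const_mul' _ _ (ENNReal.mul_ne_top ENNReal.ofReal_ne_top ENNReal.ofReal_ne_top)]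
    refine lintegral_congr fun t ↦ ?_
    have : Complex.polarCoord.symm (ρ, t) ∈ unitDisc := by
      rw [unitDisc, mem_ofPred_eq, hn]; exact h1
    rw [Pi.mul_apply, indicator_of_mem this, hn, smul_eq_mul, mul_assoc]
  · rw [indicator_of_notMem (by simp [h1]), ← lintegral_zero
      (μ := volume.restrict (Ioo (-Real.pi) Real.pi))]
    refine lintegral_congr fun t ↦ ?_
    have : Complex.polarCoord.symm (ρ, t) ∉ unitDisc := by
      rw [unitDisc, mem_ofPred_eq, hn]; exact h1
    rw [Pi.mul_apply, indicator_of_notMem this, zero_mul, smul_zero]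

/-- The measure of an arc of length `h`. -/
def arcMass (h : ℝ) : ENNReal := volume (Icc (-(h / 2)) (h / 2) ∩ Ioo (-Real.pi) Real.pi)

theorem arcMass_eq (h : ℝ) :
    arcMass h = ENNReal.ofReal (min h (2 * Real.pi)) := by
  have : arcMass h = volume (Icc (-(h / 2)) (h / 2) ∩ Icc (-Real.pi) Real.pi) :=
    measure_congr ((ae_eq_refl _).inter Ioo_ae_eq_Icc)
  rw [this, Icc_inter_Icc, Real.volume_Icc]
  congr 1
  rcases le_total h (2 * Real.pi) with h1 | h1
  · rw [min_eq_left h1, min_eq_left (by linarith), max_eq_left (by linarith)]; ring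
  · rw [min_eq_right h1, min_eq_right (by linarith), max_eq_right (by linarith)]; ring

theorem weightMeasure_preimage_mul_exp (ω : ℝ → ℝ) (θ : ℝ) {s : Set ℂ} (hs : MeasurableSet s)
    (hsub : s ⊆ unitDisc) :
    weightMeasure ω ((fun z ↦ z * Complex.exp (-(θ : ℂ) * Complex.I)) ⁻¹' s) =
      weightMeasure ω s := by
  have hmp : MeasurePreserving (fun z ↦ z * Complex.exp (-(θ : ℂ) * Complex.I)) := by
    have := (rotation (Circle.exp (-θ))).measurePreserving
    convert this using 2 with z
    rw [rotation_apply, mul_comm, Circle.coe_exp]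
    simp
  have hn : ∀ z : ℂ, ‖z * Complex.exp (-(θ : ℂ) * Complex.I)‖ = ‖z‖ := fun z ↦ by
    rw [norm_mul, ← Complex.ofReal_neg, Complex.norm_exp_ofReal_mul_I, mul_one]
  have hemb : MeasurableEmbedding (fun z : ℂ ↦ z * Complex.exp (-(θ : ℂ) * Complex.I)) :=
    (Homeomorph.mulRight₀ _ (Complex.exp_ne_zero _)).measurableEmbedding
  rw [weightMeasure_apply ω hs hsub, weightMeasure_apply ω (hmp.measurable hs)]
  · rw [← hmp.setLIntegral_comp_preimage_emb hemb (fun z ↦ ENNReal.ofReal (ω ‖z‖)) s]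
    simp_rw [hn]
  · intro z hz
    have := hsub hz
    rwa [unitDisc, mem_ofPred_eq, hn] at this

theorem weightMeasure_CBox {ω : ℝ → ℝ} (hω : ContinuousOn ω (Ico 0 1)) (θ h : ℝ) :
    weightMeasure ω (CBox θ h) = arcMass h * annulusMass ω h := by
  have hrot : CBox θ h = (fun z ↦ z * Complex.exp (-(θ : ℂ) * Complex.I)) ⁻¹' CBox 0 h := by
    ext z
    simp only [CBox, mem_ofPred_eq, mem_preimage, norm_mul, ← Complex.ofReal_neg,
      Complex.norm_exp_ofReal_mul_I, mul_one]
    simp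
  rw [hrot, weightMeasure_preimage_mul_exp ω θ (measurableSet_CBox 0 h) (CBox_subset_unitDisc 0 h),
    ← lintegral_indicator_one (measurableSet_CBox 0 h), lintegral_weightMeasure_polar hω
      (measurable_one.indicator (measurableSet_CBox 0 h)), annulusMass, mul_comm,
    ← lintegral_mul_const' _ _ (by rw [arcMass_eq]; exact ENNReal.ofReal_ne_top),
    ← lintegral_indicator (measurableSet_Ioi.inter measurableSet_Ico),
    ← lintegral_indicator measurableSet_Ioo]
  refine lintegral_congr fun ρ ↦ ?_
  by_cases hρ : ρ ∈ Ioo (0:ℝ) 1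
  swap
  · rw [indicator_of_notMem hρ, indicator_of_notMem fun hh ↦ hρ ⟨hh.1, hh.2.2⟩]
  rw [indicator_of_mem hρ]
  have key : ∀ t ∈ Ioo (-Real.pi) Real.pi, (Complex.polarCoord.symm (ρ, t) ∈ CBox 0 h ↔
      1 - h ≤ ρ ∧ t ∈ Icc (-(h / 2)) (h / 2)) := by
    intro t ht
    have hn : ‖Complex.polarCoord.symm (ρ, t)‖ = ρ := by
      rw [Complex.norm_polarCoord_symm, abs_of_pos hρ.1]
    have ha : Complex.arg (Complex.polarCoord.symm (ρ, t)) = t := by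
      rw [Complex.polarCoord_symm_apply, Complex.ofReal_cos, Complex.ofReal_sin,
        Complex.arg_mul_cos_add_sin_mul_I hρ.1 ⟨ht.1, ht.2.le⟩]
    rw [CBox, mem_ofPred_eq, hn]
    simp only [Complex.ofReal_zero, neg_zero, zero_mul, Complex.exp_zero, mul_one, ha, abs_le, hρ.2,
      true_and, mem_Icc]
  by_cases h1 : 1 - h ≤ ρ
  · rw [indicator_of_mem (show ρ ∈ Ioi 0 ∩ Ico (1 - h) 1 from ⟨hρ.1, h1, hρ.2⟩), arcMass,
      ← Measure.restrict_apply measurableSet_Icc, ← lintegral_indicator_one measurableSet_Icc]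
    congr 1
    refine setLIntegral_congr_fun measurableSet_Ioo fun t ht ↦ ?_
    have := key t ht
    by_cases hm : t ∈ Icc (-(h / 2)) (h / 2)
    · rw [indicator_of_mem (this.2 ⟨h1, hm⟩), indicator_of_mem hm]; rfl
    · rw [indicator_of_notMem fun hh ↦ hm (this.1 hh).2, indicator_of_notMem hm]
  · rw [indicator_of_notMem fun hh ↦ h1 hh.2.1]
    have : ∫⁻ t in Ioo (-Real.pi) Real.pi,
        (CBox 0 h).indicator 1 (Complex.polarCoord.symm (ρ, t)) = ∫⁻ t in Ioo (-Real.pi) Real.pi,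
        (0 : ENNReal) :=
      setLIntegral_congr_fun measurableSet_Ioo fun t ht ↦
        indicator_of_notMem (fun hh ↦ h1 ((key t ht).1 hh).1) _
    rw [this, lintegral_zero, mul_zero]

theorem exists_weightMeasure_doubling {ω : ℝ → ℝ}
    (hω : IsRegularWeight ω ∨ IsRapidlyIncreasing ω) :
    ∃ D : ℝ, 0 < D ∧ ∀ θ, ∀ h > 0,
      weightMeasure ω (CBox θ (2 * h)) ≤ ENNReal.ofReal D * weightMeasure ω (CBox θ h) := by
  have hw : ContinuousOn ω (Ico 0 1) := by rcases hω with h | h <;> exact h.1.2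
  obtain ⟨D, hD, h⟩ := exists_annulusMass_doubling hω
  refine ⟨2 * D, by positivity, fun θ h' hh' ↦ ?_⟩
  rw [weightMeasure_CBox hw, weightMeasure_CBox hw, ENNReal.ofReal_mul zero_le_two,
    mul_mul_mul_comm]
  gcongr
  · rw [arcMass_eq, arcMass_eq, ← ENNReal.ofReal_mul zero_le_two]
    refine ENNReal.ofReal_le_ofReal ?_
    rw [mul_min_of_nonneg _ _ zero_le_two]
    exact min_le_min le_rfl (by linarith [Real.pi_pos])
  · exact h h' hh'

theorem weightMeasure_CBox_pos {ω : ℝ → ℝ} (hω : IsRadialContinuousWeight ω) (θ : ℝ) {h : ℝ}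
    (hh : 0 < h) : 0 < weightMeasure ω (CBox θ h) := by
  rw [weightMeasure_CBox hω.2, arcMass_eq]
  exact ENNReal.mul_pos (by simp [hh, Real.pi_pos]) (annulusMass_pos hω.1 hh).ne'

theorem isFiniteMeasure_weightMeasure {ω : ℝ → ℝ} (hω : IsRadialContinuousWeight ω) :
    IsFiniteMeasure (weightMeasure ω) := by
  refine ⟨?_⟩
  have h1 : weightMeasure ω univ = weightMeasure ω unitDisc := by
    rw [← lintegral_one, lintegral_weightMeasure hω.2,
      weightMeasure_apply ω measurableSet_unitDisc subset_rfl]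
    simp
  rw [h1, ← CBox_eq_unitDisc 0 le_rfl, weightMeasure_CBox hω.2, arcMass_eq]
  exact ENNReal.mul_lt_top ENNReal.ofReal_lt_top (annulusMass_lt_top hω.1 (by positivity))

/-- A bounded analytic function concentrated on the Carleson square `CBox θ δ`. -/
def localizer (θ δ : ℝ) (z : ℂ) : ℂ :=
  δ / (1 - (1 - δ) * (z * Complex.exp (-(θ : ℂ) * Complex.I)))

theorem norm_mul_exp_neg (θ : ℝ) (z : ℂ) : ‖z * Complex.exp (-(θ : ℂ) * Complex.I)‖ = ‖z‖ := by
  rw [norm_mul, ← Complex.ofReal_neg, Complex.norm_exp_ofReal_mul_I, mul_one]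

section Localizer

variable {θ δ : ℝ}

theorem norm_one_sub_mul_le (hδ1 : δ ≤ 1) (w : ℂ) : ‖(1 - (δ : ℂ)) * w‖ = (1 - δ) * ‖w‖ := by
  rw [norm_mul, ← Complex.ofReal_one, ← Complex.ofReal_sub, Complex.norm_real, Real.norm_eq_abs,
    abs_of_nonneg (by linarith)]

theorem one_sub_le_norm_one_sub (hδ1 : δ ≤ 1) (w : ℂ) :
    1 - (1 - δ) * ‖w‖ ≤ ‖1 - (1 - (δ : ℂ)) * w‖ := by
  have := norm_sub_norm_le (1 : ℂ) ((1 - (δ : ℂ)) * w)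
  rwa [norm_one_sub_mul_le hδ1, norm_one] at this

theorem abs_arg_le_norm_one_sub_mul (hδ1 : δ ≤ 1) (w : ℂ) :
    |Complex.arg w| / Real.pi ≤ ‖1 - (1 - (δ : ℂ)) * w‖ := by
  set t := Complex.arg w
  have hre : w.re = ‖w‖ * Real.cos t := (Complex.norm_mul_cos_arg w).symm
  have him : w.im = ‖w‖ * Real.sin t := (Complex.norm_mul_sin_arg w).symm
  set s := (1 - δ) * ‖w‖ with hs
  have hs0 : 0 ≤ s := mul_nonneg (by linarith) (norm_nonneg _)
  have h1 : (1 - (1 - (δ : ℂ)) * w).re = 1 - s * Real.cos t := by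
    simp [hre, hs]; ring
  have h2 : (1 - (1 - (δ : ℂ)) * w).im = - (s * Real.sin t) := by
    simp [him, hs]; ring
  have hcos : Real.cos |t| = Real.cos t := Real.cos_abs t
  have hpi := Real.pi_pos
  rcases le_or_gt |t| (Real.pi / 2) with h | h
  · have hsin := Real.mul_le_sin (abs_nonneg t) h
    have hsq : Real.sin |t| ^ 2 = Real.sin t ^ 2 := by
      rw [Real.sin_sq, Real.sin_sq, hcos]
    calc |t| / Real.pi ≤ 2 / Real.pi * |t| := by
          rw [div_mul_eq_mul_div]; gcongr; linarith [abs_nonneg t]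
      _ ≤ Real.sin |t| := hsin
      _ ≤ |Real.sin (|t|)| := le_abs_self _
      _ ≤ _ := by
        rw [← Real.sqrt_sq_eq_abs, Complex.norm_eq_sqrt_sq_add_sq, h1, h2]
        apply Real.sqrt_le_sqrt
        rw [hsq]
        nlinarith [sq_nonneg (s - Real.cos t), Real.sin_sq_add_cos_sq t]
  · have hc : Real.cos t ≤ 0 := by
      rw [← hcos]
      exact Real.cos_nonpos_of_pi_div_two_le_of_le h.le
        (by linarith [Complex.abs_arg_le_pi w])
    calc |t| / Real.pi ≤ 1 := by
          rw [div_le_one hpi]; exact Complex.abs_arg_le_pi w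
      _ ≤ 1 - s * Real.cos t := by nlinarith
      _ ≤ _ := by rw [← h1]; exact Complex.re_le_norm _

theorem one_sub_mul_ne_zero (hδ : 0 < δ) (hδ1 : δ ≤ 1) {w : ℂ} (hw : ‖w‖ < 1) :
    1 - (1 - (δ : ℂ)) * w ≠ 0 := by
  rw [← norm_pos_iff]
  have := one_sub_le_norm_one_sub hδ1 w
  nlinarith [norm_nonneg w]

theorem norm_localizer (hδ : 0 < δ) (z : ℂ) : ‖localizer θ δ z‖ =
    δ / ‖1 - (1 - (δ : ℂ)) * (z * Complex.exp (-(θ : ℂ) * Complex.I))‖ := by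
  rw [localizer, norm_div, Complex.norm_real, Real.norm_eq_abs, abs_of_pos hδ]

theorem norm_localizer_le_one (hδ : 0 < δ) (hδ1 : δ ≤ 1) {z : ℂ} (hz : ‖z‖ < 1) :
    ‖localizer θ δ z‖ ≤ 1 := by
  have h := one_sub_le_norm_one_sub hδ1 (z * Complex.exp (-(θ : ℂ) * Complex.I))
  rw [norm_mul_exp_neg] at h
  rw [norm_localizer hδ]
  exact div_le_one_of_le₀ (by nlinarith [norm_nonneg z]) (norm_nonneg _)

theorem localizer_ne_zero (hδ : 0 < δ) (hδ1 : δ ≤ 1) {z : ℂ} (hz : ‖z‖ < 1) :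
    localizer θ δ z ≠ 0 :=
  div_ne_zero (by exact_mod_cast hδ.ne')
    (one_sub_mul_ne_zero hδ hδ1 (by rwa [norm_mul_exp_neg]))

theorem differentiableOn_localizer (hδ : 0 < δ) (hδ1 : δ ≤ 1) :
    DifferentiableOn ℂ (localizer θ δ) unitDisc := by
  refine DifferentiableOn.div (by fun_prop) (by fun_prop) fun z hz ↦
    one_sub_mul_ne_zero hδ hδ1 ?_
  rw [norm_mul_exp_neg]; exact hz

theorem norm_localizer_le_of_notMem (hδ : 0 < δ) (hδ1 : δ ≤ 1) {z : ℂ} (hz : ‖z‖ < 1) {m : ℝ}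
    (hm : 0 < m) (hmem : z ∉ CBox θ (m * δ)) : ‖localizer θ δ z‖ ≤ 2 * Real.pi / m := by
  set w := z * Complex.exp (-(θ : ℂ) * Complex.I) with hw
  have hwz : ‖w‖ = ‖z‖ := norm_mul_exp_neg θ z
  have hpi := Real.pi_gt_three
  have key : m * δ / (2 * Real.pi) ≤ ‖1 - (1 - (δ : ℂ)) * w‖ := by
    rcases lt_or_ge ‖z‖ (1 - m * δ) with h | h
    · have h1 := one_sub_le_norm_one_sub hδ1 w
      rw [hwz] at h1
      calc m * δ / (2 * Real.pi) ≤ m * δ := div_le_self (by positivity) (by linarith)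
        _ ≤ _ := by nlinarith [norm_nonneg z]
    · have h2 : m * δ / 2 < |Complex.arg w| := by
        by_contra! hcon
        exact hmem ⟨h, hz, hcon⟩
      refine le_trans ?_ (abs_arg_le_norm_one_sub_mul hδ1 w)
      rw [← div_div]
      gcongr
  rw [norm_localizer hδ, ← hw, div_le_div_iff₀ (lt_of_lt_of_le (by positivity) key) hm]
  rw [div_le_iff₀ (by positivity)] at key
  linarith

theorem le_norm_localizer (hδ : 0 < δ) (hδ1 : δ ≤ 1) {z : ℂ} (hz : ‖z‖ < 1)
    (hzδ : 1 - δ ≤ ‖z‖)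
    (harg : |Complex.arg (z * Complex.exp (-(θ : ℂ) * Complex.I))| ≤ Real.pi * δ) :
    1 / 6 ≤ ‖localizer θ δ z‖ := by
  set w := z * Complex.exp (-(θ : ℂ) * Complex.I) with hw
  have hwz : ‖w‖ = ‖z‖ := norm_mul_exp_neg θ z
  have h0 := norm_pos_iff.2 (one_sub_mul_ne_zero hδ hδ1 (hwz ▸ hz))
  rw [norm_localizer hδ, ← hw, div_le_div_iff₀ (by norm_num) h0, one_mul]
  set t := Complex.arg w
  have e : 1 - (1 - (δ : ℂ)) * w = ((1 - ‖w‖ : ℝ) : ℂ) -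
      ‖w‖ * (Complex.exp (Complex.I * t) - 1) + δ * w := by
    have : (‖w‖ : ℂ) * Complex.exp (Complex.I * t) = w := by
      rw [mul_comm Complex.I]; exact Complex.norm_mul_exp_arg_mul_I w
    push_cast
    linear_combination this
  have hpi := Real.pi_lt_four
  have hexp : ‖Complex.exp (Complex.I * t) - 1‖ ≤ |t| := Real.norm_exp_I_mul_ofReal_sub_one_le
  calc ‖1 - (1 - (δ : ℂ)) * w‖ ≤ ‖((1 - ‖w‖ : ℝ) : ℂ)‖ +
      ‖(‖w‖ : ℂ) * (Complex.exp (Complex.I * t) - 1)‖ + ‖(δ : ℂ) * w‖ := by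
        rw [e]
        exact (norm_add_le _ _).trans (by gcongr; exact norm_sub_le _ _)
    _ ≤ δ + 1 * (Real.pi * δ) + δ * 1 := by
        rw [norm_mul (‖w‖ : ℂ), norm_mul (δ : ℂ), Complex.norm_real, Complex.norm_real,
          Complex.norm_real, norm_norm, Real.norm_eq_abs, Real.norm_eq_abs, hwz,
          abs_of_nonneg (by linarith), abs_of_pos hδ]
        gcongr
        · linarith
        · exact hexp.trans harg
    _ ≤ δ * 6 := by nlinarith

theorem ofReal_norm_localizer_rpow_le (hδ : 0 < δ) (hδ1 : δ ≤ 1) {β : ℝ} (hβ : 0 < β) {z : ℂ}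
    (hz : ‖z‖ < 1) : ENNReal.ofReal (‖localizer θ δ z‖ ^ β) ≤
      ∑' k : ℕ, ENNReal.ofReal ((4 * Real.pi) ^ β) * ENNReal.ofReal (2 ^ β)⁻¹ ^ k *
        (CBox θ (2 ^ k * δ)).indicator 1 z := by
  have hpi := Real.pi_gt_three
  have hex : ∃ k : ℕ, z ∈ CBox θ (2 ^ k * δ) := by
    obtain ⟨k, hk⟩ := pow_unbounded_of_one_lt (2 * Real.pi / δ) (one_lt_two : (1:ℝ) < 2)
    refine ⟨k, ?_⟩
    rw [CBox_eq_unitDisc θ ((div_lt_iff₀ hδ).1 hk).le]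
    exact hz
  classical
  set k := Nat.find hex with hk
  have hmem : z ∈ CBox θ (2 ^ k * δ) := Nat.find_spec hex
  have hle : ‖localizer θ δ z‖ ≤ 4 * Real.pi / 2 ^ k := by
    rcases Nat.eq_zero_or_pos k with h0 | hpos
    · rw [h0, pow_zero, div_one]
      exact (norm_localizer_le_one hδ hδ1 hz).trans (by linarith)
    · obtain ⟨j, hj⟩ := Nat.exists_eq_succ_of_ne_zero hpos.ne'
      have := Nat.find_min hex (m := j) (by omega)
      refine (norm_localizer_le_of_notMem hδ hδ1 hz (by positivity) this).trans (le_of_eq ?_)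
      rw [hj, Nat.succ_eq_add_one, pow_succ]
      field_simp
      ring
  refine le_trans ?_ (ENNReal.le_tsum k)
  rw [indicator_of_mem hmem, Pi.one_apply, mul_one, ← ENNReal.ofReal_pow (by positivity),
    ← ENNReal.ofReal_mul (by positivity)]
  refine ENNReal.ofReal_le_ofReal ((Real.rpow_le_rpow (norm_nonneg _) hle hβ.le).trans_eq ?_)
  rw [Real.div_rpow (by positivity) (by positivity), div_eq_mul_inv, inv_pow,
    ← Real.rpow_natCast, ← Real.rpow_natCast, ← Real.rpow_mul zero_le_two,
    ← Real.rpow_mul zero_le_two, mul_comm β]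

/-- Integrals against powers of the localizer are controlled by averages over Carleson squares. -/
theorem lintegral_localizer_le {ν : Measure ℂ} {D β : ℝ}
    (hν : ∀ᵐ z ∂ν, ‖z‖ < 1)
    (hD : ∀ θ, ∀ h > 0, ν (CBox θ (2 * h)) ≤ ENNReal.ofReal D * ν (CBox θ h))
    (hβ : 0 < β) (hDβ : D * 2 ≤ 2 ^ β) (hδ : 0 < δ) (hδ1 : δ ≤ 1) {φ : ℂ → ENNReal}
    (hφ : AEMeasurable φ ν) {M : ENNReal}
    (hM : ∀ h, δ ≤ h → ∫⁻ z in CBox θ h, φ z ∂ν ≤ M * ν (CBox θ h)) :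
    ∫⁻ z, ENNReal.ofReal (‖localizer θ δ z‖ ^ β) * φ z ∂ν ≤
      ENNReal.ofReal (2 * (4 * Real.pi) ^ β) * (M * ν (CBox θ δ)) := by
  have hiter : ∀ k : ℕ, ν (CBox θ (2 ^ k * δ)) ≤ ENNReal.ofReal D ^ k * ν (CBox θ δ) := by
    intro k
    induction k with
    | zero => simp
    | succ k ih =>
      calc ν (CBox θ (2 ^ (k + 1) * δ)) = ν (CBox θ (2 * (2 ^ k * δ))) := by ring_nf
        _ ≤ _ := hD θ _ (by positivity)
        _ ≤ ENNReal.ofReal D * (ENNReal.ofReal D ^ k * ν (CBox θ δ)) := by gcongr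
        _ = _ := by ring
  have h2β : (0:ℝ) < 2 ^ β := by positivity
  have hratio : ENNReal.ofReal (2 ^ β)⁻¹ * ENNReal.ofReal D ≤ 2⁻¹ := by
    rw [← ENNReal.ofReal_mul (by positivity),
      show (2⁻¹ : ENNReal) = ENNReal.ofReal 2⁻¹ by
        rw [ENNReal.ofReal_inv_of_pos two_pos, ENNReal.ofReal_ofNat]]
    refine ENNReal.ofReal_le_ofReal ?_
    rw [inv_mul_le_iff₀ h2β]
    linarith
  set c := ENNReal.ofReal ((4 * Real.pi) ^ β)
  calc ∫⁻ z, ENNReal.ofReal (‖localizer θ δ z‖ ^ β) * φ z ∂ν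
      ≤ ∫⁻ z, ∑' k : ℕ, c * ENNReal.ofReal (2 ^ β)⁻¹ ^ k *
        (CBox θ (2 ^ k * δ)).indicator φ z ∂ν := by
        refine lintegral_mono_ae ?_
        filter_upwards [hν] with z hz
        refine (mul_le_mul_left (ofReal_norm_localizer_rpow_le hδ hδ1 hβ hz) _).trans_eq ?_
        rw [← ENNReal.tsum_mul_right]
        refine tsum_congr fun k ↦ ?_
        by_cases hm : z ∈ CBox θ (2 ^ k * δ) <;> simp [hm, c]
    _ = ∑' k : ℕ, c * ENNReal.ofReal (2 ^ β)⁻¹ ^ k * ∫⁻ z in CBox θ (2 ^ k * δ), φ z ∂ν := by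
        rw [lintegral_tsum fun k ↦ (hφ.indicator (measurableSet_CBox _ _)).const_mul _]
        refine tsum_congr fun k ↦ ?_
        rw [lintegral_const_mul' _ _ (by finiteness), lintegral_indicator (measurableSet_CBox _ _)]
    _ ≤ ∑' k : ℕ, (c * (M * ν (CBox θ δ))) * 2⁻¹ ^ k := by
        refine ENNReal.tsum_le_tsum fun k ↦ ?_
        have h1 : δ ≤ 2 ^ k * δ := le_mul_of_one_le_left hδ.le (one_le_pow₀ one_le_two)
        calc c * ENNReal.ofReal (2 ^ β)⁻¹ ^ k * ∫⁻ z in CBox θ (2 ^ k * δ), φ z ∂ν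
            ≤ c * ENNReal.ofReal (2 ^ β)⁻¹ ^ k *
              (M * (ENNReal.ofReal D ^ k * ν (CBox θ δ))) := by
              gcongr
              exact (hM _ h1).trans (by gcongr; exact hiter k)
          _ = (c * (M * ν (CBox θ δ))) * (ENNReal.ofReal (2 ^ β)⁻¹ * ENNReal.ofReal D) ^ k := by
              rw [mul_pow]; ring
          _ ≤ _ := by gcongr
    _ = _ := by
        rw [ENNReal.tsum_mul_left, ENNReal.tsum_geometric, ENNReal.one_sub_inv_two, inv_inv,
          ENNReal.ofReal_mul zero_le_two, ENNReal.ofReal_ofNat]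
        ring

end Localizer

theorem countable_zeros_unitDisc {f : ℂ → ℂ} (hf : DifferentiableOn ℂ f unitDisc) {a : ℂ}
    (ha : a ∈ unitDisc) (hfa : f a ≠ 0) : {z ∈ unitDisc | f z = 0}.Countable := by
  have hball : unitDisc = Metric.ball 0 1 := by ext; simp [unitDisc]
  have hopen : IsOpen unitDisc := hball ▸ Metric.isOpen_ball
  have hconn : IsConnected unitDisc :=
    hball ▸ (convex_ball 0 1).isConnected ⟨0, by simp⟩
  have h := (hf.analyticOnNhd hopen).preimage_zero_mem_codiscreteWithin hfa ha hconn
  have hdisc : IsDiscrete (f ⁻¹' {0} ∩ unitDisc) := isDiscrete_of_codiscreteWithin h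
  refine ((HereditarilyLindelofSpace.isLindelof _).countable_of_isDiscrete hdisc).mono ?_
  exact fun z hz ↦ ⟨hz.2, hz.1⟩

theorem ae_weightMeasure_norm_lt_one (ω : ℝ → ℝ) : ∀ᵐ z ∂(weightMeasure ω), ‖z‖ < 1 := by
  have : weightMeasure ω unitDiscᶜ = 0 := by
    rw [weightMeasure, withDensity_apply _ measurableSet_unitDisc.compl,
      setLIntegral_congr_fun measurableSet_unitDisc.compl
        fun z hz ↦ indicator_of_notMem hz _, lintegral_zero]
  exact this

theorem ofReal_norm_rpow_le_of_average_le {ω : ℝ → ℝ} (hω : IsRadialContinuousWeight ω)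
    {D D' : ℝ} (hD' : 0 < D')
    (hD : ∀ θ, ∀ h > 0,
      weightMeasure ω (CBox θ (2 * h)) ≤ ENNReal.ofReal D * weightMeasure ω (CBox θ h))
    (hA : ∀ h > 0, annulusMass ω (2 * h) ≤ ENNReal.ofReal D' * annulusMass ω h)
    {α : ℝ} (hα : 0 < α) :
    ∃ C : ℝ, 0 < C ∧ ∀ f : ℂ → ℂ, DifferentiableOn ℂ f unitDisc → ∀ a ∈ unitDisc,
      ∀ M : ENNReal, (∀ θ h, 0 < h → a ∈ CBox θ h →
        ∫⁻ z in CBox θ h, ENNReal.ofReal (‖f z‖ ^ α) ∂(weightMeasure ω) ≤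
          M * weightMeasure ω (CBox θ h)) →
      ENNReal.ofReal (‖f a‖ ^ α) ≤ ENNReal.ofReal C * M := by
  obtain ⟨N, hN1, hN⟩ : ∃ N : ℕ, 0 < N ∧ D * 2 ≤ 2 ^ (N * α) := by
    obtain ⟨N, hN⟩ := pow_unbounded_of_one_lt (D * 2)
      (Real.one_lt_rpow (one_lt_two : (1:ℝ) < 2) hα)
    refine ⟨N + 1, by omega, hN.le.trans ?_⟩
    rw [mul_comm, Real.rpow_mul zero_le_two, Real.rpow_natCast]
    exact pow_le_pow_right₀ (Real.one_le_rpow one_le_two hα.le) (by omega)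
  set β : ℝ := N * α
  have hβ : 0 < β := by positivity
  have hpi := Real.pi_pos
  set Cβ : ℝ := 2 * (4 * Real.pi) ^ β
  have hCβ : 0 < Cβ := by positivity
  refine ⟨6 ^ β * (4 * Cβ * D'), by positivity, fun f hf a ha M hM ↦ ?_⟩
  have hball : unitDisc = Metric.ball 0 1 := by ext; simp [unitDisc]
  have hopen : IsOpen unitDisc := hball ▸ Metric.isOpen_ball
  rcases eq_or_ne (f a) 0 with hfa | hfa
  · simp [hfa, Real.zero_rpow hα.ne']
  set δ := 1 - ‖a‖ with hδdef
  have hδ : 0 < δ := sub_pos.2 ha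
  have hδ1 : δ ≤ 1 := by linarith [norm_nonneg a]
  set θ := Complex.arg a
  have harg : Complex.arg (a * Complex.exp (-(θ : ℂ) * Complex.I)) = 0 := by
    conv_lhs => rw [← Complex.norm_mul_exp_arg_mul_I a]
    rw [mul_assoc, ← Complex.exp_add, show (Complex.arg a : ℂ) * Complex.I + -(θ : ℂ) * Complex.I
      = 0 by ring, Complex.exp_zero, mul_one, Complex.arg_ofReal_of_nonneg (norm_nonneg _)]
  have hmem : ∀ h, δ ≤ h → a ∈ CBox θ h := fun h hh ↦
    ⟨by linarith, ha, by rw [harg, abs_zero]; linarith⟩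
  set F : ℂ → ℂ := fun z ↦ f z * localizer θ δ z ^ N with hF
  have hFd : DifferentiableOn ℂ F unitDisc :=
    hf.mul ((differentiableOn_localizer hδ hδ1).pow N)
  have hFn : ∀ z, ‖F z‖ ^ α = ‖localizer θ δ z‖ ^ β * ‖f z‖ ^ α := fun z ↦ by
    rw [hF, norm_mul, norm_pow, Real.mul_rpow (norm_nonneg _) (by positivity),
      ← Real.rpow_natCast, ← Real.rpow_mul (norm_nonneg _), mul_comm]
  set ν := weightMeasure ω
  have hνd : ∀ᵐ z ∂ν, ‖z‖ < 1 := ae_weightMeasure_norm_lt_one ω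
  have hmeas : ∀ {g : ℂ → ℂ}, DifferentiableOn ℂ g unitDisc →
      Measurable (unitDisc.indicator fun z ↦ ENNReal.ofReal (‖g z‖ ^ α)) := by
    intro g hg
    have hc : ContinuousOn (fun z ↦ ENNReal.ofReal (‖g z‖ ^ α)) unitDisc :=
      ENNReal.continuous_ofReal.comp_continuousOn
        (hg.continuousOn.norm.rpow_const fun _ _ ↦ Or.inr hα.le)
    classical
    rw [← piecewise_eq_indicator]
    exact hc.measurable_piecewise continuousOn_const measurableSet_unitDisc
  have hLM := lintegral_localizer_le (θ := θ) hνd hD hβ hN hδ hδ1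
    (φ := unitDisc.indicator fun z ↦ ENNReal.ofReal (‖f z‖ ^ α)) (hmeas hf).aemeasurable
    (M := M) (fun h hh ↦ by
      refine le_trans (le_of_eq ?_) (hM θ h (hδ.trans_le hh) (hmem h hh))
      exact setLIntegral_congr_fun (measurableSet_CBox _ _) fun z hz ↦
        indicator_of_mem (CBox_subset_unitDisc θ h hz) _)
  have hint : ∫⁻ z, unitDisc.indicator (fun z ↦ ENNReal.ofReal (‖F z‖ ^ α)) z ∂ν ≤
      ENNReal.ofReal Cβ * (M * ν (CBox θ δ)) := by
    refine le_trans (lintegral_mono fun z ↦ ?_) hLM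
    by_cases hz : z ∈ unitDisc
    · rw [indicator_of_mem hz, indicator_of_mem hz, hFn, ENNReal.ofReal_mul (by positivity)]
    · simp [hz]
  rw [lintegral_weightMeasure_polar hω.2 (hmeas hFd)] at hint
  set A := annulusMass ω (δ / 2) with hAdef
  have hA0 : A ≠ 0 := (annulusMass_pos hω.1 (by positivity)).ne'
  have hAt : A ≠ ⊤ := (annulusMass_lt_top hω.1 (by positivity)).ne
  have hbad : {ρ : ℝ | ∃ z ∈ unitDisc, f z = 0 ∧ ‖z‖ = ρ}.Countable := by
    refine ((countable_zeros_unitDisc hf ha hfa).image fun z ↦ ‖z‖).mono ?_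
    rintro ρ ⟨z, hz, hz0, rfl⟩
    exact ⟨z, ⟨hz, hz0⟩, rfl⟩
  set G : ℝ → ENNReal := fun ρ ↦ ∫⁻ t in Ioo (-Real.pi) Real.pi,
    unitDisc.indicator (fun z ↦ ENNReal.ofReal (‖F z‖ ^ α)) (Complex.polarCoord.symm (ρ, t)) with hG
  have hcirc : ∀ᵐ ρ ∂(volume.restrict (Ioi 0 ∩ Ico (1 - δ / 2) 1)),
      ENNReal.ofReal (‖F a‖ ^ α) ≤ ENNReal.ofReal (4 / δ) * G ρ := by
    filter_upwards [ae_restrict_mem (measurableSet_Ioi.inter measurableSet_Ico),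
      ae_restrict_of_ae (hbad.ae_notMem volume)] with ρ hρ hgood
    obtain ⟨h0, h1, h2⟩ := hρ
    have hsub : Metric.closedBall (0:ℂ) ρ ⊆ unitDisc := fun z hz ↦
      lt_of_le_of_lt (by simpa using hz) h2
    have haρ : δ / 2 ≤ ρ - ‖a‖ := by linarith
    refine (ofReal_norm_rpow_le_lintegral (by linarith) hα
      ((hFd.analyticOnNhd hopen).mono hsub) fun z hz ↦ ?_).trans ?_
    · have hzd := hsub (Metric.sphere_subset_closedBall hz)
      exact mul_ne_zero (fun h ↦ hgood ⟨z, hzd, h, by simpa using hz⟩)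
        (pow_ne_zero _ (localizer_ne_zero hδ hδ1 hzd))
    · gcongr ?_ * ?_
      · refine ENNReal.ofReal_le_ofReal ?_
        rw [div_le_div_iff₀ (by linarith) hδ]
        nlinarith [show ‖a‖ < 1 from ha]
      · refine le_of_eq (lintegral_congr fun t ↦ ?_)
        rw [indicator_of_mem]
        rw [unitDisc, mem_ofPred_eq, Complex.norm_polarCoord_symm, abs_of_pos h0]
        exact h2
  have hmain : ENNReal.ofReal (‖F a‖ ^ α) * A ≤ ENNReal.ofReal (4 * Cβ * D') * M * A := by
    calc ENNReal.ofReal (‖F a‖ ^ α) * A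
        = ∫⁻ ρ in Ioi 0 ∩ Ico (1 - δ / 2) 1,
          ENNReal.ofReal (‖F a‖ ^ α) * (ENNReal.ofReal ρ * ENNReal.ofReal (ω ρ)) := by
          rw [lintegral_const_mul' _ _ ENNReal.ofReal_ne_top, hAdef, annulusMass]
      _ ≤ ∫⁻ ρ in Ioi 0 ∩ Ico (1 - δ / 2) 1,
          ENNReal.ofReal (4 / δ) * (ENNReal.ofReal ρ * ENNReal.ofReal (ω ρ) * G ρ) := by
          refine lintegral_mono_ae ?_
          filter_upwards [hcirc] with ρ hρ
          calc _ ≤ ENNReal.ofReal (4 / δ) * G ρ * (ENNReal.ofReal ρ * ENNReal.ofReal (ω ρ)) := by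
                gcongr
            _ = _ := by ring
      _ ≤ ENNReal.ofReal (4 / δ) *
          ∫⁻ ρ in Ioo 0 1, ENNReal.ofReal ρ * ENNReal.ofReal (ω ρ) * G ρ := by
          rw [lintegral_const_mul' _ _ ENNReal.ofReal_ne_top]
          gcongr
          exact fun x hx ↦ ⟨hx.1, hx.2.2⟩
      _ ≤ ENNReal.ofReal (4 / δ) * (ENNReal.ofReal Cβ * (M * (ENNReal.ofReal δ *
          (ENNReal.ofReal D' * A)))) := by
          gcongr
          refine hint.trans ?_
          gcongr
          rw [weightMeasure_CBox hω.2]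
          gcongr
          · exact arcMass_eq δ ▸ ENNReal.ofReal_le_ofReal (min_le_left _ _)
          · have := hA (δ / 2) (by positivity)
            rwa [mul_div_cancel₀ _ two_ne_zero] at this
      _ = ENNReal.ofReal (4 / δ * Cβ * δ * D') * M * A := by
          rw [ENNReal.ofReal_mul (p := 4 / δ * Cβ * δ) (by positivity),
            ENNReal.ofReal_mul (p := 4 / δ * Cβ) (by positivity),
            ENNReal.ofReal_mul (p := 4 / δ) (by positivity)]
          ring
      _ = _ := by
          congr 3
          field_simp
  have hFa : ENNReal.ofReal (‖F a‖ ^ α) ≤ ENNReal.ofReal (4 * Cβ * D') * M :=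
    (ENNReal.mul_le_mul_iff_left hA0 hAt).1 hmain
  have h6 : 1 / 6 ≤ ‖localizer θ δ a‖ := le_norm_localizer hδ hδ1 ha (by linarith)
    (by rw [harg, abs_zero]; positivity)
  have hfF : ‖f a‖ ^ α ≤ 6 ^ β * ‖F a‖ ^ α := by
    have h1 : (1 / 6 : ℝ) ^ β ≤ ‖localizer θ δ a‖ ^ β :=
      Real.rpow_le_rpow (by norm_num) h6 hβ.le
    have h2 : (6:ℝ) ^ β * (1 / 6) ^ β = 1 := by
      rw [← Real.mul_rpow (by norm_num) (by norm_num)]; norm_num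
    rw [hFn, ← mul_assoc]
    refine le_mul_of_one_le_left (by positivity) ?_
    rw [← h2]
    gcongr
  calc ENNReal.ofReal (‖f a‖ ^ α) ≤ ENNReal.ofReal (6 ^ β * ‖F a‖ ^ α) :=
        ENNReal.ofReal_le_ofReal hfF
    _ = ENNReal.ofReal (6 ^ β) * ENNReal.ofReal (‖F a‖ ^ α) := ENNReal.ofReal_mul (by positivity)
    _ ≤ ENNReal.ofReal (6 ^ β) * (ENNReal.ofReal (4 * Cβ * D') * M) := by gcongr
    _ = _ := by rw [← mul_assoc, ← ENNReal.ofReal_mul (by positivity)]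

theorem tsum_rpow_le_rpow_tsum {ι : Type*} (x : ι → ENNReal) {s : ℝ} (hs : 1 ≤ s) :
    ∑' i, x i ^ s ≤ (∑' i, x i) ^ s := by
  have h : ∀ y : ENNReal, y ^ s = y * y ^ (s - 1) := fun y ↦ by
    conv_lhs => rw [show s = 1 + (s - 1) by ring,
      ENNReal.rpow_add_of_nonneg _ _ zero_le_one (by linarith), ENNReal.rpow_one]
  rw [h (∑' i, x i), ← ENNReal.tsum_mul_right]
  refine ENNReal.tsum_le_tsum fun i ↦ ?_
  rw [h]
  gcongr
  · exact ENNReal.le_tsum i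

/-- Covering estimate for the set where some average over a Carleson square exceeds `l`. -/
theorem measure_iUnion_CBox_le {ν μ : Measure ℂ} [IsFiniteMeasure ν] {D : ENNReal}
    (hD : ∀ θ, ∀ h > 0, ν (CBox θ (2 * h)) ≤ D * ν (CBox θ h))
    (hpos : ∀ θ, ∀ h > 0, 0 < ν (CBox θ h)) {s : ℝ} (hs : 1 ≤ s) {K : ENNReal}
    (hK : ∀ θ, ∀ h > 0, μ (CBox θ h) ≤ K * ν (CBox θ h) ^ s) (ψ : ℂ → ENNReal) {l : ENNReal}
    (hl0 : l ≠ 0) (hlt : l ≠ ⊤) :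
    μ {z | ∃ θ h, 0 < h ∧ h ≤ 2 * Real.pi ∧ z ∈ CBox θ h ∧
      l * ν (CBox θ h) < ∫⁻ z in CBox θ h, ψ z ∂ν} ≤
      K * (D ^ 3 * (l⁻¹ * ∫⁻ z, ψ z ∂ν)) ^ s := by
  set T : Set (ℝ × ℝ) := {x | 0 < x.2 ∧ x.2 ≤ 2 * Real.pi ∧
    l * ν (CBox x.1 x.2) < ∫⁻ z in CBox x.1 x.2, ψ z ∂ν}
  obtain ⟨u, hut, hdisj, hcov⟩ := Vitali.exists_disjoint_subfamily_covering_enlargement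
    (fun x : ℝ × ℝ ↦ CBox x.1 x.2) T (fun x ↦ x.2) 2 one_lt_two (fun x hx ↦ hx.1.le)
    (2 * Real.pi) (fun x hx ↦ hx.2.1) (fun x hx ↦ exists_mem_CBox hx.1 x.1)
  have hdisj' : Pairwise (Function.onFun Disjoint fun x : u ↦ CBox x.1.1 x.1.2) :=
    fun x y hxy ↦ hdisj x.2 y.2 (by simpa [Subtype.ext_iff] using hxy)
  have hcount : Countable u := by
    have := Measure.countable_meas_pos_of_disjoint_iUnion (μ := ν)
      (fun x : u ↦ measurableSet_CBox x.1.1 x.1.2) hdisj'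
    rw [← Set.countable_univ_iff]
    exact this.mono fun x _ ↦ hpos _ _ (hut x.2).1
  have hsub : {z | ∃ θ h, 0 < h ∧ h ≤ 2 * Real.pi ∧ z ∈ CBox θ h ∧
      l * ν (CBox θ h) < ∫⁻ z in CBox θ h, ψ z ∂ν} ⊆
      ⋃ x : u, CBox x.1.1 (8 * x.1.2) := by
    rintro z ⟨θ, h, h0, h1, hz, hlarge⟩
    obtain ⟨b, hb, hne, hle⟩ := hcov (θ, h) ⟨h0, h1, hlarge⟩
    exact mem_iUnion.2 ⟨⟨b, hb⟩, CBox_subset_of_inter (hut hb).1 hle hne hz⟩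
  have h8 : ∀ θ, ∀ h > 0, ν (CBox θ (8 * h)) ≤ D ^ 3 * ν (CBox θ h) := by
    intro θ h hh
    calc ν (CBox θ (8 * h)) = ν (CBox θ (2 * (2 * (2 * h)))) := by ring_nf
      _ ≤ D * (D * (D * ν (CBox θ h))) := by
        refine (hD θ _ (by positivity)).trans ?_
        gcongr
        refine (hD θ _ (by positivity)).trans ?_
        gcongr
        exact hD θ _ hh
      _ = _ := by ring
  calc μ _ ≤ μ (⋃ x : u, CBox x.1.1 (8 * x.1.2)) := measure_mono hsub
    _ ≤ ∑' x : u, μ (CBox x.1.1 (8 * x.1.2)) := measure_iUnion_le _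
    _ ≤ ∑' x : u, K * (D ^ 3 * (l⁻¹ * ∫⁻ z in CBox x.1.1 x.1.2, ψ z ∂ν)) ^ s := by
        refine ENNReal.tsum_le_tsum fun x ↦ ?_
        have hx := hut x.2
        have hx0 : (0:ℝ) < x.1.2 := hx.1
        refine (hK _ _ (by positivity)).trans ?_
        gcongr
        refine (h8 _ _ hx.1).trans ?_
        gcongr
        rw [← ENNReal.div_eq_inv_mul, ENNReal.le_div_iff_mul_le (Or.inl hl0) (Or.inl hlt), mul_comm]
        exact hx.2.2.le
    _ ≤ K * (∑' x : u, D ^ 3 * (l⁻¹ * ∫⁻ z in CBox x.1.1 x.1.2, ψ z ∂ν)) ^ s := by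
        rw [ENNReal.tsum_mul_left]
        gcongr
        exact tsum_rpow_le_rpow_tsum _ hs
    _ ≤ _ := by
        rw [ENNReal.tsum_mul_left, ENNReal.tsum_mul_left,
          ← lintegral_iUnion (fun x : u ↦ measurableSet_CBox x.1.1 x.1.2) hdisj']
        gcongr
        exact Measure.restrict_le_self

theorem lintegral_rpow_le_of_average_le {ν μ : Measure ℂ} [IsFiniteMeasure ν] {D : ENNReal}
    (hD : ∀ θ, ∀ h > 0, ν (CBox θ (2 * h)) ≤ D * ν (CBox θ h))
    (hpos : ∀ θ, ∀ h > 0, 0 < ν (CBox θ h)) {s : ℝ} (hs : 1 ≤ s) {K : ENNReal}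
    (hDt : D ≠ ⊤)
    (hK : ∀ θ, ∀ h > 0, μ (CBox θ h) ≤ K * ν (CBox θ h) ^ s) (hμ : ∀ᵐ z ∂μ, z ∈ unitDisc)
    {g : ℂ → ℝ} (hg : Measurable g) (hg0 : ∀ z, 0 ≤ g z) {C : ℝ} (hC : 0 < C)
    (hpt : ∀ a ∈ unitDisc, ∀ M : ENNReal, (∀ θ h, 0 < h → h ≤ 2 * Real.pi → a ∈ CBox θ h →
      ∫⁻ z in CBox θ h, ENNReal.ofReal (g z) ∂ν ≤ M * ν (CBox θ h)) →
      ENNReal.ofReal (g a) ≤ ENNReal.ofReal C * M) :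
    ∫⁻ z, ENNReal.ofReal (g z ^ (2 * s)) ∂μ ≤
      ENNReal.ofReal (2 * s) * (D ^ 3 * ENNReal.ofReal (2 * C)) ^ s *
        ENNReal.ofReal (2 * C) ^ s * K * (∫⁻ z, ENNReal.ofReal (g z ^ (2:ℝ)) ∂ν) ^ s := by
  set N := ∫⁻ z, ENNReal.ofReal (g z ^ (2:ℝ)) ∂ν with hN
  set G : ℝ → ENNReal := fun t ↦ ∫⁻ z in {z | t < 2 * C * g z}, ENNReal.ofReal (g z) ∂ν with hG
  have hmset : ∀ t, MeasurableSet {z | t < 2 * C * g z} := fun t ↦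
    measurableSet_lt measurable_const (hg.const_mul _)
  have hGanti : Antitone G := fun a b hab ↦
    lintegral_mono_set fun z (hz : b < _) ↦ lt_of_le_of_lt hab hz
  have hdens : Measurable fun z ↦ ENNReal.ofReal (g z) := hg.ennreal_ofReal
  have hmul : ∀ z, ENNReal.ofReal (2 * C * g z) * ENNReal.ofReal (g z) =
      ENNReal.ofReal (2 * C) * ENNReal.ofReal (g z ^ (2:ℝ)) := fun z ↦ by
    rw [ENNReal.ofReal_mul (by positivity), mul_assoc, ← ENNReal.ofReal_mul (hg0 z), ← sq,
      Real.rpow_two]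
  have hGint : ∫⁻ t in Ioi 0, G t = ENNReal.ofReal (2 * C) * N := by
    have h := lintegral_eq_lintegral_meas_lt (ν.withDensity fun z ↦ ENNReal.ofReal (g z))
      (f := fun z ↦ 2 * C * g z) (Eventually.of_forall fun z ↦ by
        have := hg0 z; simp only [Pi.zero_apply]; positivity)
      (hg.const_mul _).aemeasurable
    rw [lintegral_withDensity_eq_lintegral_mul _ hdens (hg.const_mul _).ennreal_ofReal] at h
    rw [hN, ← lintegral_const_mul' _ _ ENNReal.ofReal_ne_top]
    calc ∫⁻ t in Ioi 0, G t = ∫⁻ t in Ioi 0,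
          (ν.withDensity fun z ↦ ENNReal.ofReal (g z)) {z | t < 2 * C * g z} :=
          lintegral_congr fun t ↦ (withDensity_apply _ (hmset t)).symm
      _ = _ := h.symm
      _ = _ := lintegral_congr fun z ↦ by rw [← hmul, Pi.mul_apply, mul_comm]
  have hGle : ∀ t > 0, ENNReal.ofReal t * G t ≤ ENNReal.ofReal (2 * C) * N := by
    intro t ht
    rw [hG, hN, ← lintegral_const_mul' _ _ ENNReal.ofReal_ne_top,
      ← lintegral_const_mul' _ _ ENNReal.ofReal_ne_top]
    refine (setLIntegral_mono' (hmset t) fun z (hz : t < _) ↦ ?_).trans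
      (setLIntegral_le_lintegral {z | t < 2 * C * g z} _)
    rw [← hmul]
    gcongr
  set B : ENNReal := (D ^ 3 * ENNReal.ofReal (2 * C)) ^ s with hB
  have hs0 : 0 ≤ s := by linarith
  have hBt : B ≠ ⊤ := ENNReal.rpow_ne_top_of_nonneg hs0 (by finiteness)
  have hlevel : ∀ t > 0, μ {z | t < g z} ≤ K * (B * (ENNReal.ofReal t ^ (-s) * G t ^ s)) := by
    intro t ht
    set l := ENNReal.ofReal (t / (2 * C)) with hl
    have hl0 : l ≠ 0 := by simp only [hl, ne_eq, ENNReal.ofReal_eq_zero, not_le]; positivity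
    have hw := measure_iUnion_CBox_le hD hpos hs hK
      ({z | t < 2 * C * g z}.indicator fun z ↦ ENNReal.ofReal (g z)) hl0 ENNReal.ofReal_ne_top
    rw [lintegral_indicator (hmset t)] at hw
    have hlinv : l⁻¹ = ENNReal.ofReal (2 * C) * (ENNReal.ofReal t)⁻¹ := by
      rw [hl, ← ENNReal.ofReal_inv_of_pos (by positivity), ← ENNReal.ofReal_inv_of_pos ht,
        ← ENNReal.ofReal_mul (by positivity), inv_div, div_eq_mul_inv]
    have hrhs : K * (D ^ 3 * (l⁻¹ * G t)) ^ s = K * (B * (ENNReal.ofReal t ^ (-s) * G t ^ s)) := by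
      rw [hlinv, ENNReal.rpow_neg, ← ENNReal.inv_rpow, ← ENNReal.mul_rpow_of_nonneg _ _ hs0, hB,
        ← ENNReal.mul_rpow_of_nonneg _ _ hs0]
      congr 2
      ring
    refine le_trans (measure_mono_ae ?_) (hw.trans_eq hrhs)
    filter_upwards [hμ] with a ha (hta : t < g a)
    by_contra hcon
    have hall : ∀ θ h, 0 < h → h ≤ 2 * Real.pi → a ∈ CBox θ h →
        ∫⁻ z in CBox θ h, ENNReal.ofReal (g z) ∂ν ≤ ENNReal.ofReal (t / C) * ν (CBox θ h) := by
      intro θ h h0 h1 hmem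
      have hle : ∫⁻ z in CBox θ h, {z | t < 2 * C * g z}.indicator
          (fun z ↦ ENNReal.ofReal (g z)) z ∂ν ≤ l * ν (CBox θ h) := by
        by_contra! hlt
        exact hcon ⟨θ, h, h0, h1, hmem, hlt⟩
      calc ∫⁻ z in CBox θ h, ENNReal.ofReal (g z) ∂ν
          ≤ ∫⁻ z in CBox θ h, ({z | t < 2 * C * g z}.indicator
            (fun z ↦ ENNReal.ofReal (g z)) z + l) ∂ν := by
            refine lintegral_mono fun z ↦ ?_
            by_cases hz : t < 2 * C * g z
            · rw [indicator_of_mem (show z ∈ {z | t < 2 * C * g z} from hz)]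
              exact le_self_add
            · rw [indicator_of_notMem (show z ∉ {z | t < 2 * C * g z} from hz), zero_add]
              refine ENNReal.ofReal_le_ofReal ?_
              rw [le_div_iff₀ (by positivity)]
              linarith
        _ = (∫⁻ z in CBox θ h, {z | t < 2 * C * g z}.indicator
            (fun z ↦ ENNReal.ofReal (g z)) z ∂ν) + l * ν (CBox θ h) := by
            rw [lintegral_add_right _ measurable_const, setLIntegral_const]
        _ ≤ l * ν (CBox θ h) + l * ν (CBox θ h) := by gcongr
        _ = _ := by
            rw [← add_mul, hl, ← ENNReal.ofReal_add (by positivity) (by positivity)]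
            congr 2
            field_simp
            ring
    have := hpt a ha _ hall
    rw [← ENNReal.ofReal_mul hC.le, mul_div_cancel₀ _ hC.ne',
      ENNReal.ofReal_le_ofReal_iff ht.le] at this
    exact absurd hta this.not_gt
  have hsplit : ∀ y : ENNReal, y ^ s = y ^ (s - 1) * y := fun y ↦ by
    conv_lhs => rw [show s = (s - 1) + 1 by ring,
      ENNReal.rpow_add_of_nonneg _ _ (by linarith) zero_le_one, ENNReal.rpow_one]
  rw [lintegral_rpow_eq_lintegral_meas_lt_mul μ (Eventually.of_forall hg0) hg.aemeasurable
    (by linarith)]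
  calc ENNReal.ofReal (2 * s) * ∫⁻ t in Ioi 0, μ {a | t < g a} * ENNReal.ofReal (t ^ (2 * s - 1))
      ≤ ENNReal.ofReal (2 * s) * ∫⁻ t in Ioi 0,
        (K * B * (ENNReal.ofReal (2 * C) * N) ^ (s - 1)) * G t := by
        refine mul_le_mul' le_rfl (setLIntegral_mono' measurableSet_Ioi fun t (ht : 0 < t) ↦ ?_)
        have htp : ENNReal.ofReal t ^ (-s) * ENNReal.ofReal (t ^ (2 * s - 1)) =
            ENNReal.ofReal t ^ (s - 1) := by
          rw [← ENNReal.ofReal_rpow_of_pos ht, ← ENNReal.rpow_add _ _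
            (by simpa using ht) ENNReal.ofReal_ne_top]
          congr 1; ring
        calc μ {a | t < g a} * ENNReal.ofReal (t ^ (2 * s - 1))
            ≤ K * (B * (ENNReal.ofReal t ^ (-s) * G t ^ s)) * ENNReal.ofReal (t ^ (2 * s - 1)) := by
              gcongr; exact hlevel t ht
          _ = K * B * (ENNReal.ofReal t ^ (-s) * ENNReal.ofReal (t ^ (2 * s - 1))) *
              (G t ^ (s - 1) * G t) := by rw [hsplit (G t)]; ring
          _ = K * B * (ENNReal.ofReal t * G t) ^ (s - 1) * G t := by
              rw [htp, ENNReal.mul_rpow_of_nonneg _ _ (by linarith)]; ring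
          _ ≤ _ := mul_le_mul' (mul_le_mul' le_rfl
              (ENNReal.rpow_le_rpow (hGle t ht) (by linarith))) le_rfl
    _ = ENNReal.ofReal (2 * s) * (K * B * ((ENNReal.ofReal (2 * C) * N) ^ (s - 1) *
        (ENNReal.ofReal (2 * C) * N))) := by
        rw [lintegral_const_mul _ hGanti.measurable, hGint]; ring
    _ = _ := by
        rw [← hsplit, ENNReal.mul_rpow_of_nonneg _ _ hs0]; ring

theorem CBox_min (θ h : ℝ) : CBox θ (min h (2 * Real.pi)) = CBox θ h := by
  rcases le_total h (2 * Real.pi) with hh | hh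
  · rw [min_eq_left hh]
  · rw [min_eq_right hh, CBox_eq_unitDisc θ le_rfl, CBox_eq_unitDisc θ hh]

theorem exists_carleson_of_embedding {p q : ℝ} (hp : 0 < p) (hpq : p ≤ q) {ω : ℝ → ℝ}
    (hω : IsRegularWeight ω ∨ IsRapidlyIncreasing ω) :
    ∃ c : ℝ, 0 < c ∧ ∀ μ : Measure ℂ, ∀ C : ℝ, 0 ≤ C →
      (∀ f : ℂ → ℂ, DifferentiableOn ℂ f unitDisc →
        (∫⁻ z, ENNReal.ofReal (‖f z‖ ^ q) ∂μ) ≤ ENNReal.ofReal C *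
          (∫⁻ z in unitDisc, ENNReal.ofReal (‖f z‖ ^ p * ω ‖z‖)) ^ (q / p)) →
      ∀ θ h : ℝ, 0 < h → h ≤ 2 * Real.pi →
        μ (CBox θ h) ≤ ENNReal.ofReal (c * C) *
          (∫⁻ ξ in CBox θ h, ENNReal.ofReal (ω ‖ξ‖)) ^ (q / p) := by
  have hcw : IsRadialContinuousWeight ω := by rcases hω with h | h <;> exact h.1
  obtain ⟨D, -, hD⟩ := exists_weightMeasure_doubling hω
  obtain ⟨N, hN⟩ := pow_unbounded_of_one_lt (D * 2)
    (Real.one_lt_rpow (one_lt_two : (1:ℝ) < 2) hp)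
  have hN' : D * 2 ≤ 2 ^ ((N + 1 : ℕ) * p) := by
    refine hN.le.trans ?_
    rw [mul_comm, Real.rpow_mul zero_le_two, Real.rpow_natCast]
    exact pow_le_pow_right₀ (Real.one_le_rpow one_le_two hp.le) (by omega)
  set n := N + 1
  have hβ : (0:ℝ) < n * p := by positivity
  have hq : 0 < q := hp.trans_le hpq
  have hs : 0 ≤ q / p := by positivity
  have hpi := Real.pi_pos
  set B : ℝ := 2 * (4 * Real.pi) ^ (n * p) with hB
  refine ⟨6 ^ (n * q) * B ^ (q / p), by positivity, fun μ C hC hemb θ h h0 h1 ↦ ?_⟩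
  set δ := min h 1
  have hδ : 0 < δ := lt_min h0 one_pos
  have hδ1 : δ ≤ 1 := min_le_right _ _
  have hpow : ∀ (r : ℝ) (z : ℂ), ‖localizer θ δ z ^ n‖ ^ r = ‖localizer θ δ z‖ ^ (n * r) := fun r z ↦ by
    rw [norm_pow, ← Real.rpow_natCast, ← Real.rpow_mul (norm_nonneg _)]
  have hf := hemb (fun z ↦ localizer θ δ z ^ n) ((differentiableOn_localizer hδ hδ1).pow n)
  have hlow : ∀ z ∈ CBox θ h, 1 ≤ (6:ℝ) ^ (n * q) * ‖localizer θ δ z ^ n‖ ^ q := by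
    intro z hz
    have h6 : 1 / 6 ≤ ‖localizer θ δ z‖ := by
      refine le_norm_localizer hδ hδ1 hz.2.1 ?_ (hz.2.2.trans ?_)
      · rcases min_choice h 1 with e | e
        · simp only [δ, e]; exact hz.1
        · simp [δ, e]
      · rcases min_choice h 1 with e | e
        · simp only [δ, e]; nlinarith [Real.pi_gt_three]
        · simp only [δ, e]; linarith
    rw [hpow, ← Real.mul_rpow (by norm_num) (norm_nonneg _)]
    exact Real.one_le_rpow (by linarith) (by positivity)
  have hnorm : ∫⁻ z in unitDisc, ENNReal.ofReal (‖localizer θ δ z ^ n‖ ^ p * ω ‖z‖) ≤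
      ENNReal.ofReal B * weightMeasure ω (CBox θ h) := by
    have := lintegral_localizer_le (θ := θ) (ae_weightMeasure_norm_lt_one ω) hD hβ hN' hδ hδ1
      (φ := 1) aemeasurable_const (M := 1) (fun h _ ↦ by simp)
    simp only [Pi.one_apply, mul_one, one_mul] at this
    rw [lintegral_weightMeasure hcw.2] at this
    calc _ = ∫⁻ z in unitDisc, ENNReal.ofReal (‖localizer θ δ z‖ ^ (n * p)) *
          ENNReal.ofReal (ω ‖z‖) := lintegral_congr fun z ↦ by
          rw [hpow, ENNReal.ofReal_mul (by positivity)]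
      _ ≤ _ := this
      _ ≤ _ := by gcongr; exact CBox_mono θ (min_le_left _ _)
  rw [← weightMeasure_apply ω (measurableSet_CBox θ h) (CBox_subset_unitDisc θ h)]
  calc μ (CBox θ h) = ∫⁻ z in CBox θ h, 1 ∂μ := by simp
    _ ≤ ∫⁻ z in CBox θ h,
        ENNReal.ofReal (6 ^ (n * q)) * ENNReal.ofReal (‖localizer θ δ z ^ n‖ ^ q) ∂μ := by
        refine setLIntegral_mono' (measurableSet_CBox θ h) fun z hz ↦ ?_
        rw [← ENNReal.ofReal_mul (by positivity), ENNReal.one_le_ofReal]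
        exact hlow z hz
    _ ≤ ENNReal.ofReal (6 ^ (n * q)) * ∫⁻ z, ENNReal.ofReal (‖localizer θ δ z ^ n‖ ^ q) ∂μ := by
        rw [lintegral_const_mul' _ _ ENNReal.ofReal_ne_top]
        gcongr
        exact Measure.restrict_le_self
    _ ≤ ENNReal.ofReal (6 ^ (n * q)) * (ENNReal.ofReal C *
        (ENNReal.ofReal B * weightMeasure ω (CBox θ h)) ^ (q / p)) := by
        gcongr
        exact hf.trans (by gcongr)
    _ = _ := by
        rw [ENNReal.mul_rpow_of_nonneg _ _ hs, ENNReal.ofReal_rpow_of_pos (by positivity),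
          ENNReal.ofReal_mul (by positivity), ENNReal.ofReal_mul (by positivity)]
        ring

theorem exists_embedding_of_carleson {p q : ℝ} (hp : 0 < p) (hpq : p ≤ q) {ω : ℝ → ℝ}
    (hω : IsRegularWeight ω ∨ IsRapidlyIncreasing ω) :
    ∃ c : ℝ, 0 < c ∧ ∀ μ : Measure ℂ, μ {z : ℂ | ¬ ‖z‖ < 1} = 0 → ∀ K : ℝ, 0 ≤ K →
      (∀ θ h : ℝ, 0 < h → h ≤ 2 * Real.pi →
        μ (CBox θ h) ≤ ENNReal.ofReal K *
          (∫⁻ ξ in CBox θ h, ENNReal.ofReal (ω ‖ξ‖)) ^ (q / p)) →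
      ∀ f : ℂ → ℂ, DifferentiableOn ℂ f unitDisc →
        (∫⁻ z, ENNReal.ofReal (‖f z‖ ^ q) ∂μ) ≤ ENNReal.ofReal (c * K) *
          (∫⁻ z in unitDisc, ENNReal.ofReal (‖f z‖ ^ p * ω ‖z‖)) ^ (q / p) := by
  have hcw : IsRadialContinuousWeight ω := by rcases hω with h | h <;> exact h.1
  obtain ⟨D, hD0, hD⟩ := exists_weightMeasure_doubling hω
  obtain ⟨D', hD', hA⟩ := exists_annulusMass_doubling hω
  obtain ⟨C, hC, hpt⟩ := ofReal_norm_rpow_le_of_average_le hcw hD' hD hA (half_pos hp)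
  have hs : 1 ≤ q / p := (one_le_div hp).2 hpq
  have hs0 : 0 ≤ q / p := by linarith
  refine ⟨2 * (q / p) * (D ^ 3 * (2 * C)) ^ (q / p) * (2 * C) ^ (q / p), by positivity,
    fun μ hμ K hK hcar f hf ↦ ?_⟩
  have := isFiniteMeasure_weightMeasure hcw
  have hμd : ∀ᵐ z ∂μ, z ∈ unitDisc := hμ
  set g : ℂ → ℝ := unitDisc.indicator fun z ↦ ‖f z‖ ^ (p / 2) with hg
  have hgm : Measurable g := by
    classical
    rw [hg, ← piecewise_eq_indicator]
    exact (hf.continuousOn.norm.rpow_const fun _ _ ↦ Or.inr (by positivity)).measurable_piecewise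
      continuousOn_const measurableSet_unitDisc
  have hgd : ∀ z ∈ unitDisc, g z = ‖f z‖ ^ (p / 2) := fun z hz ↦ indicator_of_mem hz _
  have hK' : ∀ θ, ∀ h > 0, μ (CBox θ h) ≤
      ENNReal.ofReal K * weightMeasure ω (CBox θ h) ^ (q / p) := by
    intro θ h hh
    rw [← CBox_min, weightMeasure_apply ω (measurableSet_CBox _ _) (CBox_subset_unitDisc _ _)]
    exact hcar θ _ (lt_min hh (by positivity)) (min_le_right _ _)
  have hmain := lintegral_rpow_le_of_average_le hD
    (fun θ h hh ↦ weightMeasure_CBox_pos hcw θ hh) hs ENNReal.ofReal_ne_top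
    hK' hμd hgm (fun z ↦ indicator_nonneg (fun _ _ ↦ by positivity) z) hC
    (fun a ha M hM ↦ by
      rw [hgd a ha]
      refine hpt f hf a ha M fun θ h hh hmem ↦ ?_
      rw [← CBox_min] at hmem ⊢
      refine le_trans (le_of_eq ?_)
        (hM θ _ (lt_min hh (by positivity)) (min_le_right _ _) hmem)
      exact setLIntegral_congr_fun (measurableSet_CBox _ _) fun z hz ↦ by
        simp only [hgd z (CBox_subset_unitDisc _ _ hz)])
  have hL : ∫⁻ z, ENNReal.ofReal (‖f z‖ ^ q) ∂μ =
      ∫⁻ z, ENNReal.ofReal (g z ^ (2 * (q / p))) ∂μ := by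
    refine lintegral_congr_ae ?_
    filter_upwards [hμd] with z hz
    rw [hgd z hz, ← Real.rpow_mul (norm_nonneg _)]
    congr 2
    field_simp
  have hR : ∫⁻ z, ENNReal.ofReal (g z ^ (2:ℝ)) ∂(weightMeasure ω) =
      ∫⁻ z in unitDisc, ENNReal.ofReal (‖f z‖ ^ p * ω ‖z‖) := by
    rw [lintegral_weightMeasure hcw.2]
    refine setLIntegral_congr_fun measurableSet_unitDisc fun z hz ↦ ?_
    rw [hgd z hz, ← Real.rpow_mul (norm_nonneg _), ENNReal.ofReal_mul (by positivity),
      div_mul_cancel₀ _ two_ne_zero]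
  rw [hL, ← hR]
  refine hmain.trans_eq ?_
  rw [← ENNReal.ofReal_pow hD0.le, ← ENNReal.ofReal_mul (by positivity),
    ENNReal.ofReal_rpow_of_pos (by positivity), ENNReal.ofReal_rpow_of_pos (by positivity),
    ← ENNReal.ofReal_mul (by positivity), ← ENNReal.ofReal_mul (by positivity),
    ← ENNReal.ofReal_mul (by positivity)]

theorem stmt8 (p q : ℝ) (hp : 0 < p) (hpq : p ≤ q) (ω : ℝ → ℝ)
    (hω : IsRegularWeight ω ∨ IsRapidlyIncreasing ω) :
    ∃ c₁ c₂ : ℝ, 0 < c₁ ∧ 0 < c₂ ∧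
      ∀ μ : Measure ℂ, μ {z : ℂ | ¬ ‖z‖ < 1} = 0 →
        -- the qualitative characterization:
        (((∃ C : ℝ, 0 < C ∧ ∀ f : ℂ → ℂ, DifferentiableOn ℂ f unitDisc →
            (∫⁻ z, ENNReal.ofReal (‖f z‖ ^ q) ∂μ) ≤
              ENNReal.ofReal C *
                (∫⁻ z in unitDisc, ENNReal.ofReal (‖f z‖ ^ p * ω ‖z‖)) ^ (q / p)) ↔
          (∃ K : ℝ, 0 ≤ K ∧ ∀ θ h : ℝ, 0 < h → h ≤ 2 * Real.pi →
            μ (CBox θ h) ≤ ENNReal.ofReal K *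
              (∫⁻ ξ in CBox θ h, ENNReal.ofReal (ω ‖ξ‖)) ^ (q / p))) ∧
        -- `‖I_d‖^q ≲ sup_I μ(S(I))/ω(S(I))^{q/p}`:
        (∀ K : ℝ, 0 ≤ K →
          (∀ θ h : ℝ, 0 < h → h ≤ 2 * Real.pi →
            μ (CBox θ h) ≤ ENNReal.ofReal K *
              (∫⁻ ξ in CBox θ h, ENNReal.ofReal (ω ‖ξ‖)) ^ (q / p)) →
          ∀ f : ℂ → ℂ, DifferentiableOn ℂ f unitDisc →
            (∫⁻ z, ENNReal.ofReal (‖f z‖ ^ q) ∂μ) ≤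
              ENNReal.ofReal (c₂ * K) *
                (∫⁻ z in unitDisc, ENNReal.ofReal (‖f z‖ ^ p * ω ‖z‖)) ^ (q / p)) ∧
        -- `sup_I μ(S(I))/ω(S(I))^{q/p} ≲ ‖I_d‖^q`:
        (∀ C : ℝ, 0 ≤ C →
          (∀ f : ℂ → ℂ, DifferentiableOn ℂ f unitDisc →
            (∫⁻ z, ENNReal.ofReal (‖f z‖ ^ q) ∂μ) ≤
              ENNReal.ofReal C *
                (∫⁻ z in unitDisc, ENNReal.ofReal (‖f z‖ ^ p * ω ‖z‖)) ^ (q / p)) →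
          ∀ θ h : ℝ, 0 < h → h ≤ 2 * Real.pi →
            μ (CBox θ h) ≤ ENNReal.ofReal (c₁ * C) *
              (∫⁻ ξ in CBox θ h, ENNReal.ofReal (ω ‖ξ‖)) ^ (q / p))) := by
  obtain ⟨c₁, hc₁, h₁⟩ := exists_carleson_of_embedding hp hpq hω
  obtain ⟨c₂, hc₂, h₂⟩ := exists_embedding_of_carleson hp hpq hω
  refine ⟨c₁, c₂, hc₁, hc₂, fun μ hμ ↦ ⟨⟨?_, ?_⟩, h₂ μ hμ, h₁ μ⟩⟩
  · rintro ⟨C, hC, h⟩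
    exact ⟨c₁ * C, by positivity, h₁ μ C hC.le h⟩
  · rintro ⟨K, hK, h⟩
    refine ⟨c₂ * K + 1, by positivity, fun f hf ↦ (h₂ μ hμ K hK h f hf).trans ?_⟩
    gcongr
    linarith
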